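/- Let k > 0 be real, let Ω ⊂ ℝ³ be a nonempty bounded open set with closure K, and let p : K → ℂ be continuous with Im p(y) ≤ 0 for all y ∈ K. Let T be the operator on the Banach space C(K, ℂ) defined by (T u)(x) = ∫_Ω exp(i k ‖x − y‖)/(4π ‖x − y‖) p(y) u(y) dy. Then the operator I + T is bijective on C(K, ℂ) and its inverse is a bounded linear operator; equivalently, for every f ∈ C(K, ℂ) the equation u + T u = f has exactly one solution u ∈ C(K, ℂ), and the solution depends continuously on f. -/

import Mathlib

open MeasureTheory Filter Real
open scoped Topology Classical

noncomputable section

/-- Euclidean 3-space. -/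
abbrev E3 := EuclideanSpace ℝ (Fin 3)

/-- The free-space Green's function of the Helmholtz operator `Δ + k²` in `ℝ³`. -/
def greens (k : ℝ) (x y : E3) : ℂ :=
  Complex.exp (Complex.I * (k : ℂ) * (‖x - y‖ : ℂ)) / ((4 * Real.pi * ‖x - y‖ : ℝ) : ℂ)

/-- The function `‖z‖⁻²` cut off to the unit ball. -/
def invSqCutoff (z : E3) : ℝ := (Metric.ball (0 : E3) 1).indicator (fun z => (‖z‖ ^ 2)⁻¹) z

lemma invSqCutoff_nonneg (z : E3) : 0 ≤ invSqCutoff z :=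
  Set.indicator_nonneg (fun _ _ => by positivity) _

lemma integrable_invSqCutoff : Integrable invSqCutoff := by
  unfold invSqCutoff
  rw [integrable_indicator_iff Metric.isOpen_ball.measurableSet]
  have := (integrableOn_fun_norm_addHaar (E := E3) volume (f := fun y : ℝ => (y ^ 2)⁻¹)
    (r := 1)).2
  refine this ?_
  have h1 : IntegrableOn (fun _ : ℝ => (1 : ℝ)) (Set.Ioo 0 1) := by simp
  refine h1.congr_fun (fun y hy => ?_) measurableSet_Ioo
  have : y ≠ 0 := hy.1.ne'
  simp [this]

lemma integrable_invSqCutoff_sub (x : E3) : Integrable (fun y => invSqCutoff (x - y)) :=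
  integrable_invSqCutoff.comp_sub_left x

lemma integral_invSqCutoff_sub (x : E3) :
    ∫ y, invSqCutoff (x - y) = ∫ z, invSqCutoff z :=
  integral_sub_left_eq_self _ _ _

lemma inv_sq_norm_le (z : E3) : (‖z‖ ^ 2)⁻¹ ≤ 1 + invSqCutoff z := by
  unfold invSqCutoff
  by_cases hz : z ∈ Metric.ball (0 : E3) 1
  · rw [Set.indicator_of_mem hz]; linarith
  · rw [Set.indicator_of_notMem hz]
    have : 1 ≤ ‖z‖ := by simpa using hz
    have : 1 ≤ ‖z‖ ^ 2 := one_le_pow₀ this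
    simpa using inv_le_one_of_one_le₀ this

lemma inv_norm_le (z : E3) : ‖z‖⁻¹ ≤ 1 + invSqCutoff z := by
  by_cases hz : z ∈ Metric.ball (0 : E3) 1
  · have h := inv_sq_norm_le z
    unfold invSqCutoff at *
    rw [Set.indicator_of_mem hz] at *
    rw [← inv_pow]
    nlinarith [sq_nonneg (‖z‖⁻¹ - 1), sq_nonneg ‖z‖⁻¹]
  · unfold invSqCutoff
    rw [Set.indicator_of_notMem hz]
    have : 1 ≤ ‖z‖ := by simpa using hz
    simpa using inv_le_one_of_one_le₀ this

lemma one_le_four_pi : 1 ≤ 4 * π := by linarith [Real.pi_gt_three]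

lemma norm_exp_I_mul_real (k r : ℝ) : ‖Complex.exp (Complex.I * k * r)‖ = 1 := by
  rw [show Complex.I * k * r = ((k * r : ℝ) : ℂ) * Complex.I by push_cast; ring]
  exact Complex.norm_exp_ofReal_mul_I _

lemma norm_greens_le (k : ℝ) (x y : E3) : ‖greens k x y‖ ≤ 1 + invSqCutoff (x - y) := by
  unfold greens
  rw [norm_div, norm_exp_I_mul_real, Complex.norm_real, Real.norm_of_nonneg (by positivity)]
  refine le_trans ?_ (inv_norm_le (x - y))
  rw [one_div, mul_inv]
  exact mul_le_of_le_one_left (by positivity) (inv_le_one_of_one_le₀ one_le_four_pi)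

lemma measurable_greens (k : ℝ) : Measurable (fun z : E3 × E3 => greens k z.1 z.2) := by
  unfold greens
  fun_prop

lemma norm_greens_sub_le (k : ℝ) (x x' y : E3) :
    ‖greens k x y - greens k x' y‖ ≤
      (|k| + 1) * (2 + invSqCutoff (x - y) + invSqCutoff (x' - y)) * ‖x - x'‖ := by
  have hI := inv_sq_norm_le (x - y)
  have hI' := inv_sq_norm_le (x' - y)
  have hJ := inv_norm_le (x - y)
  have n1 := invSqCutoff_nonneg (x - y)
  have n2 := invSqCutoff_nonneg (x' - y)
  have hab : |‖x - y‖ - ‖x' - y‖| ≤ ‖x - x'‖ := by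
    simpa using abs_norm_sub_norm_le (x - y) (x' - y)
  unfold greens
  set a := ‖x - y‖
  set b := ‖x' - y‖
  have ha : 0 ≤ a := norm_nonneg _
  have hb : 0 ≤ b := norm_nonneg _
  have key : ‖Complex.exp (Complex.I * k * a) * (a⁻¹ : ℝ)
      - Complex.exp (Complex.I * k * b) * (b⁻¹ : ℝ)‖
      ≤ |a - b| * (|k| * a⁻¹ + ((a ^ 2)⁻¹ + (b ^ 2)⁻¹)) := by
    have h2 : |a⁻¹ - b⁻¹| ≤ |a - b| * ((a ^ 2)⁻¹ + (b ^ 2)⁻¹) := by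
      rcases ha.eq_or_lt with h | ha'
      · rw [← h]
        rcases hb.eq_or_lt with h | hb'
        · simp [← h]
        · simp only [zero_sub, abs_neg, abs_inv, inv_zero, abs_of_pos hb']
          simp; field_simp; exact le_rfl
      · rcases hb.eq_or_lt with h | hb'
        · rw [← h]; simp [abs_of_pos ha']; field_simp; exact le_rfl
        · have : a⁻¹ - b⁻¹ = (b - a) * (a⁻¹ * b⁻¹) := by field_simp
          rw [this, abs_mul, abs_sub_comm, abs_of_pos (a := a⁻¹ * b⁻¹) (by positivity)]
          gcongr
          rw [← inv_pow, ← inv_pow]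
          nlinarith [sq_nonneg (a⁻¹ - b⁻¹), sq_nonneg a⁻¹, sq_nonneg b⁻¹]
    have h1 : ‖Complex.exp (Complex.I * k * a) - Complex.exp (Complex.I * k * b)‖
        ≤ |k| * |a - b| := by
      have e : Complex.exp (Complex.I * k * a) - Complex.exp (Complex.I * k * b)
          = Complex.exp (Complex.I * k * b) *
            (Complex.exp (Complex.I * ((k * (a - b) : ℝ) : ℂ)) - 1) := by
        rw [mul_sub, ← Complex.exp_add]; push_cast; ring_nf
      rw [e, norm_mul, norm_exp_I_mul_real, one_mul]
      refine (Real.norm_exp_I_mul_ofReal_sub_one_le).trans ?_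
      rw [Real.norm_eq_abs, abs_mul]
    have e : Complex.exp (Complex.I * k * a) * (a⁻¹ : ℝ)
        - Complex.exp (Complex.I * k * b) * (b⁻¹ : ℝ)
        = (Complex.exp (Complex.I * k * a) - Complex.exp (Complex.I * k * b)) * (a⁻¹ : ℝ)
          + Complex.exp (Complex.I * k * b) * ((a⁻¹ - b⁻¹ : ℝ) : ℂ) := by
      push_cast; ring
    rw [e]
    refine (norm_add_le _ _).trans ?_
    rw [norm_mul, norm_mul, norm_exp_I_mul_real, one_mul, Complex.norm_real, Complex.norm_real,
      Real.norm_eq_abs, Real.norm_eq_abs, abs_of_nonneg (a := a⁻¹) (by positivity)]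
    have : ‖Complex.exp (Complex.I * k * a) - Complex.exp (Complex.I * k * b)‖ * a⁻¹
        ≤ |k| * |a - b| * a⁻¹ := by gcongr
    nlinarith
  have e : ∀ r : ℝ, Complex.exp (Complex.I * k * r) / ((4 * π * r : ℝ) : ℂ)
      = ((4 * π)⁻¹ : ℝ) * (Complex.exp (Complex.I * k * r) * (r⁻¹ : ℝ)) := by
    intro r; push_cast; rw [div_eq_mul_inv, mul_inv]; ring
  rw [e, e, ← mul_sub, norm_mul, Complex.norm_real, Real.norm_of_nonneg (by positivity)]
  refine (mul_le_of_le_one_left (norm_nonneg _) (inv_le_one_of_one_le₀ one_le_four_pi)).trans ?_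
  refine key.trans ?_
  rw [mul_comm]
  have : |k| * a⁻¹ + ((a ^ 2)⁻¹ + (b ^ 2)⁻¹) ≤
      (|k| + 1) * (2 + invSqCutoff (x - y) + invSqCutoff (x' - y)) := by
    nlinarith [abs_nonneg k, mul_nonneg (abs_nonneg k) n2]
  gcongr

/-- `q` is measurable, bounded by `M` and vanishes outside the ball of radius `R`. -/
structure IsSource (q : E3 → ℂ) (M R : ℝ) : Prop where
  meas : Measurable q
  bound : ∀ y, ‖q y‖ ≤ M
  supp : ∀ y, R ≤ ‖y‖ → q y = 0

namespace IsSource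

variable {q : E3 → ℂ} {M R : ℝ}

lemma nonneg (h : IsSource q M R) : 0 ≤ M := (norm_nonneg _).trans (h.bound 0)

lemma integrable_indicator_ball (R : ℝ) :
    Integrable ((Metric.ball (0 : E3) R).indicator (1 : E3 → ℝ)) := by
  rw [integrable_indicator_iff Metric.isOpen_ball.measurableSet]
  exact integrableOn_const Metric.isBounded_ball.measure_lt_top.ne

lemma integrable_mul (h : IsSource q M R) {g : E3 → ℂ} (hg : Measurable g) {C : ℝ}
    (hC : ∀ y, ‖y‖ < R → ‖g y‖ ≤ C) : Integrable (fun y => g y * q y) := by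
  refine ((integrable_indicator_ball R).const_mul (C * M)).mono'
    (hg.mul h.meas).aestronglyMeasurable (ae_of_all _ fun y => ?_)
  by_cases hy : ‖y‖ < R
  · rw [norm_mul]
    simpa [hy] using mul_le_mul (hC y hy) (h.bound y) (norm_nonneg _)
      ((norm_nonneg _).trans (hC y hy))
  · simp [h.supp y (not_lt.1 hy), hy]

lemma integrable (h : IsSource q M R) : Integrable q := by
  simpa using h.integrable_mul (g := fun _ => 1) measurable_const (C := 1) (by simp)

lemma integrable_greens (h : IsSource q M R) (k : ℝ) (x : E3) :
    Integrable (fun y => greens k x y * q y) := by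
  refine (((integrable_indicator_ball R).add (integrable_invSqCutoff_sub x)).const_mul M).mono'
    (((measurable_greens k).comp (measurable_const.prodMk measurable_id)).mul
      h.meas).aestronglyMeasurable (ae_of_all _ fun y => ?_)
  have n1 := invSqCutoff_nonneg (x - y)
  have n2 := norm_greens_le k x y
  have n3 := h.bound y
  rw [norm_mul]
  by_cases hy : ‖y‖ < R
  · simp only [Pi.add_apply]
    rw [Set.indicator_of_mem (by simpa using hy), mul_comm]
    exact mul_le_mul n3 n2 (norm_nonneg _) h.nonneg
  · simp [h.supp y (not_lt.1 hy), hy, mul_nonneg h.nonneg n1]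

/-- The outgoing volume potential with density `q`. -/
def _root_.potential (k : ℝ) (q : E3 → ℂ) (x : E3) : ℂ := ∫ y, greens k x y * q y

lemma measurable_potential (h : IsSource q M R) (k : ℝ) : Measurable (potential k q) := by
  have : StronglyMeasurable (fun z : E3 × E3 => greens k z.1 z.2 * q z.2) :=
    ((measurable_greens k).mul (h.meas.comp measurable_snd)).stronglyMeasurable
  exact this.integral_prod_right.measurable

lemma integral_norm_greens_le (h : IsSource q M R) (k : ℝ) (x : E3) :
    ∫ y, ‖greens k x y * q y‖ ≤
      M * (volume.real (Metric.ball (0 : E3) R) + ∫ z, invSqCutoff z) := by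
  have hi := ((integrable_indicator_ball R).add (integrable_invSqCutoff_sub x)).const_mul M
  refine (integral_mono (h.integrable_greens k x).norm hi fun y => ?_).trans (le_of_eq ?_)
  · have n1 := invSqCutoff_nonneg (x - y)
    have n2 := norm_greens_le k x y
    have n3 := h.bound y
    simp only [norm_mul]
    by_cases hy : ‖y‖ < R
    · simp only [Pi.add_apply]
      rw [Set.indicator_of_mem (by simpa using hy), mul_comm]
      exact mul_le_mul n3 n2 (norm_nonneg _) h.nonneg
    · simp [h.supp y (not_lt.1 hy), hy, mul_nonneg h.nonneg n1]
  · rw [integral_const_mul]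
    simp only [Pi.add_apply]
    rw [integral_add (integrable_indicator_ball R) (integrable_invSqCutoff_sub x),
      integral_invSqCutoff_sub, integral_indicator_one Metric.isOpen_ball.measurableSet]

lemma exists_norm_potential_le (h : IsSource q M R) (k : ℝ) :
    ∃ C, ∀ x, ‖potential k q x‖ ≤ C :=
  ⟨_, fun x => (norm_integral_le_integral_norm _).trans (h.integral_norm_greens_le k x)⟩

lemma integrable_prod (h : IsSource q M R) (k : ℝ) {g : E3 → ℂ} (hg : Integrable g) :
    Integrable (fun z : E3 × E3 => g z.1 * (greens k z.1 z.2 * q z.2))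
      ((volume : Measure E3).prod (volume : Measure E3)) := by
  have hm : AEStronglyMeasurable (fun z : E3 × E3 => g z.1 * (greens k z.1 z.2 * q z.2))
      ((volume : Measure E3).prod (volume : Measure E3)) :=
    hg.aestronglyMeasurable.comp_fst.mul
      ((measurable_greens k).mul (h.meas.comp measurable_snd)).aestronglyMeasurable
  rw [integrable_prod_iff hm]
  refine ⟨ae_of_all _ fun x => (h.integrable_greens k x).const_mul (g x), ?_⟩
  refine (hg.norm.mul_const
    (M * (volume.real (Metric.ball (0 : E3) R) + ∫ z, invSqCutoff z))).mono'
    hm.norm.integral_prod_right' (ae_of_all _ fun x => ?_)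
  rw [Real.norm_of_nonneg (integral_nonneg fun _ => norm_nonneg _)]
  simp only [norm_mul (g x)]
  rw [integral_const_mul]
  exact mul_le_mul_of_nonneg_left (h.integral_norm_greens_le k x) (norm_nonneg _)

end IsSource

/-- The `i`-th standard basis vector of `ℝ³`. -/
def basisVec (i : Fin 3) : E3 := EuclideanSpace.single i 1

/-- The `i`-th partial derivative. -/
def pderiv (i : Fin 3) (φ : E3 → ℂ) (x : E3) : ℂ := fderiv ℝ φ x (basisVec i)

lemma ContDiff.pderiv {φ : E3 → ℂ} (h : ContDiff ℝ (⊤ : ℕ∞) φ) (i : Fin 3) :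
    ContDiff ℝ (⊤ : ℕ∞) (pderiv i φ) :=
  (h.fderiv_right (m := (⊤ : ℕ∞)) (by simp)).clm_apply contDiff_const

lemma HasCompactSupport.pderiv {φ : E3 → ℂ} (h : HasCompactSupport φ) (i : Fin 3) :
    HasCompactSupport (pderiv i φ) :=
  (h.fderiv (𝕜 := ℝ)).mono fun x hx => by
    rw [Function.mem_support] at hx ⊢
    contrapose! hx
    simp [_root_.pderiv, hx]

lemma ContDiff.hasLineDerivAt_pderiv {φ : E3 → ℂ} (h : ContDiff ℝ (⊤ : ℕ∞) φ) (i : Fin 3)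
    (x : E3) : HasLineDerivAt ℝ φ (_root_.pderiv i φ x) x (basisVec i) :=
  ((h.differentiable (by simp) x).hasFDerivAt).hasLineDerivAt _

lemma integral_mul_pderiv {f f' φ : E3 → ℂ} (i : Fin 3) (hf : Continuous f) (hf' : Continuous f')
    (hd : ∀ x, HasLineDerivAt ℝ f (f' x) x (basisVec i))
    (hφ : ContDiff ℝ (⊤ : ℕ∞) φ) (hc : HasCompactSupport φ) :
    ∫ x, f x * pderiv i φ x = - ∫ x, f' x * φ x := by
  have hφc := hφ.continuous
  refine integral_bilinear_hasLineDerivAt_right_eq_neg_left_of_integrable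
    (B := ContinuousLinearMap.mul ℝ ℂ) (v := basisVec i) ?_ ?_ ?_ (fun x _ => hd x)
    (fun x _ => hφ.hasLineDerivAt_pderiv i x)
  · exact (hf'.mul hφc).integrable_of_hasCompactSupport hc.mul_left
  · exact (hf.mul (hφ.pderiv i).continuous).integrable_of_hasCompactSupport (hc.pderiv i).mul_left
  · exact (hf.mul hφc).integrable_of_hasCompactSupport hc.mul_left

lemma integral_mul_pderiv_pderiv {f f' f'' φ : E3 → ℂ} (i : Fin 3) (hf : Continuous f)
    (hf' : Continuous f') (hf'' : Continuous f'')
    (hd : ∀ x, HasLineDerivAt ℝ f (f' x) x (basisVec i))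
    (hd' : ∀ x, HasLineDerivAt ℝ f' (f'' x) x (basisVec i))
    (hφ : ContDiff ℝ (⊤ : ℕ∞) φ) (hc : HasCompactSupport φ) :
    ∫ x, f x * pderiv i (pderiv i φ) x = ∫ x, f'' x * φ x := by
  rw [integral_mul_pderiv i hf hf' hd (hφ.pderiv i) (hc.pderiv i),
    integral_mul_pderiv i hf' hf'' hd' hφ hc, neg_neg]

/-- The regularized norm `√(‖x‖² + ε²)`. -/
def regNorm (ε : ℝ) (x : E3) : ℝ := √(‖x‖ ^ 2 + ε ^ 2)

lemma continuous_regNorm (ε : ℝ) : Continuous (regNorm ε) := by unfold regNorm; fun_prop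

lemma regNorm_pos {ε : ℝ} (hε : 0 < ε) (x : E3) : 0 < regNorm ε x :=
  Real.sqrt_pos.2 (by positivity)

lemma regNorm_sq (ε : ℝ) (x : E3) : regNorm ε x ^ 2 = ‖x‖ ^ 2 + ε ^ 2 :=
  Real.sq_sqrt (by positivity)

lemma hasLineDerivAt_regNorm {ε : ℝ} (hε : 0 < ε) (x : E3) (i : Fin 3) :
    HasLineDerivAt ℝ (regNorm ε) (x i / regNorm ε x) x (basisVec i) := by
  have h1 : HasDerivAt (fun t : ℝ => ‖x + t • basisVec i‖ ^ 2 + ε ^ 2) (2 * x i) 0 := by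
    have : (fun t : ℝ => ‖x + t • basisVec i‖ ^ 2 + ε ^ 2)
        = fun t : ℝ => ‖x‖ ^ 2 + t * (2 * x i) + t ^ 2 + ε ^ 2 := by
      ext t
      rw [norm_add_sq_real, inner_smul_right, norm_smul]
      simp [basisVec, EuclideanSpace.inner_single_right]
      ring
    rw [this]
    have := ((((hasDerivAt_id (0 : ℝ)).mul_const (2 * x i)).const_add (‖x‖ ^ 2)).add
      ((hasDerivAt_id (0 : ℝ)).pow 2)).add_const (ε ^ 2)
    simpa using this
  have h2 := h1.sqrt (by simp; positivity)
  unfold HasLineDerivAt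
  refine HasDerivAt.congr_deriv (f := fun t : ℝ => regNorm ε (x + t • basisVec i)) h2 ?_
  simp only [regNorm, zero_smul, add_zero]
  rw [mul_div_mul_left _ _ (two_ne_zero' ℝ)]

lemma hasLineDerivAt_coord (x : E3) (i : Fin 3) :
    HasLineDerivAt ℝ (fun x : E3 => ((x i : ℝ) : ℂ)) 1 x (basisVec i) := by
  unfold HasLineDerivAt
  have : HasDerivAt (fun t : ℝ => x i + t) 1 0 := (hasDerivAt_id (0 : ℝ)).const_add _
  simpa [basisVec] using this.ofReal_comp

/-- The radial profile `exp (i k s) / s`. -/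
def profile (k : ℝ) (s : ℝ) : ℂ := Complex.exp (Complex.I * k * s) / s

/-- The derivative of `profile` in `s`, divided by `s`. -/
def profile₁ (k : ℝ) (s : ℝ) : ℂ :=
  Complex.exp (Complex.I * k * s) * (Complex.I * k * s - 1) / s ^ 3

/-- The derivative of `profile₁` in `s`, divided by `s`. -/
def profile₂ (k : ℝ) (s : ℝ) : ℂ :=
  Complex.exp (Complex.I * k * s) * (-k ^ 2 * s ^ 2 - 3 * Complex.I * k * s + 3) / s ^ 5

lemma hasDerivAt_exp_profile (k s : ℝ) :
    HasDerivAt (fun s : ℝ => Complex.exp (Complex.I * k * s))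
      (Complex.exp (Complex.I * k * s) * (Complex.I * k)) s := by
  have : HasDerivAt (fun s : ℝ => Complex.I * k * (s : ℂ)) (Complex.I * k) s := by
    simpa using (Complex.ofRealCLM.hasDerivAt (x := s)).const_mul (Complex.I * k)
  exact this.cexp

lemma hasDerivAt_profile (k : ℝ) {s : ℝ} (hs : 0 < s) :
    HasDerivAt (profile k) (s * profile₁ k s) s := by
  have hs' : (s : ℂ) ≠ 0 := by exact_mod_cast hs.ne'
  have h := (hasDerivAt_exp_profile k s).div (Complex.ofRealCLM.hasDerivAt (x := s)) hs'
  refine h.congr_deriv ?_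
  simp only [profile₁, Complex.ofRealCLM_apply, Complex.ofReal_one]
  field_simp

lemma hasDerivAt_profile₁ (k : ℝ) {s : ℝ} (hs : 0 < s) :
    HasDerivAt (profile₁ k) (s * profile₂ k s) s := by
  have hs' : (s : ℂ) ≠ 0 := by exact_mod_cast hs.ne'
  have h0 := Complex.ofRealCLM.hasDerivAt (x := s)
  have h := ((hasDerivAt_exp_profile k s).mul ((h0.const_mul (Complex.I * k)).sub_const 1)).div
    (h0.pow 3) (by simpa using hs')
  refine h.congr_deriv ?_
  simp only [profile₂, Complex.ofRealCLM_apply, Complex.ofReal_one, Pi.mul_apply, Pi.pow_apply]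
  field_simp
  ring_nf
  simp only [Complex.I_sq]
  ring

lemma continuous_profile_comp (k : ℝ) {ε : ℝ} (hε : 0 < ε) :
    Continuous (fun x => profile k (regNorm ε x)) ∧
    Continuous (fun x => profile₁ k (regNorm ε x)) ∧
    Continuous (fun x => profile₂ k (regNorm ε x)) := by
  have h := continuous_regNorm ε
  have h0 : ∀ x, (regNorm ε x : ℂ) ≠ 0 := fun x => by exact_mod_cast (regNorm_pos hε x).ne'
  refine ⟨?_, ?_, ?_⟩
  · exact Continuous.div (by fun_prop) (by fun_prop) h0
  · exact Continuous.div (by fun_prop) (by fun_prop) fun x => pow_ne_zero _ (h0 x)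
  · exact Continuous.div (by fun_prop) (by fun_prop) fun x => pow_ne_zero _ (h0 x)

lemma HasDerivAt.hasLineDerivAt_regNorm {p : ℝ → ℂ} {p' : ℂ} {ε : ℝ} (hε : 0 < ε) {x : E3}
    (h : HasDerivAt p (regNorm ε x * p') (regNorm ε x)) (i : Fin 3) :
    HasLineDerivAt ℝ (fun x => p (regNorm ε x)) (p' * x i) x (basisVec i) := by
  have h1 := _root_.hasLineDerivAt_regNorm hε x i
  unfold HasLineDerivAt at *
  have h' : HasDerivAt p (regNorm ε x * p') (regNorm ε (x + (0 : ℝ) • basisVec i)) := by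
    simpa using h
  have := h'.scomp (0 : ℝ) h1
  refine this.congr_deriv ?_
  have h0 : (regNorm ε x : ℂ) ≠ 0 := by exact_mod_cast (regNorm_pos hε x).ne'
  simp only [Complex.real_smul]
  push_cast
  field_simp

lemma integral_regularized (k : ℝ) {ε : ℝ} (hε : 0 < ε) {φ : E3 → ℂ}
    (hφ : ContDiff ℝ (⊤ : ℕ∞) φ) (hc : HasCompactSupport φ) :
    ∫ x, profile k (regNorm ε x) * (∑ i, pderiv i (pderiv i φ) x + k ^ 2 * φ x)
      = - ∫ x, ε ^ 2 * profile₂ k (regNorm ε x) * φ x := by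
  obtain ⟨c0, c1, c2⟩ := continuous_profile_comp k hε
  have hco : ∀ i : Fin 3, Continuous (fun x : E3 => ((x i : ℝ) : ℂ)) := fun i => by fun_prop
  have hd1 : ∀ i x, HasLineDerivAt ℝ (fun x => profile k (regNorm ε x))
      (profile₁ k (regNorm ε x) * x i) x (basisVec i) := fun i x =>
    (hasDerivAt_profile k (regNorm_pos hε x)).hasLineDerivAt_regNorm hε i
  have hd2 : ∀ i x, HasLineDerivAt ℝ (fun x => profile₁ k (regNorm ε x) * x i)
      (profile₂ k (regNorm ε x) * x i * x i + profile₁ k (regNorm ε x)) x (basisVec i) := by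
    intro i x
    have h1 := (hasDerivAt_profile₁ k (regNorm_pos hε x)).hasLineDerivAt_regNorm hε i
    have h2 := hasLineDerivAt_coord x i
    unfold HasLineDerivAt at *
    refine HasDerivAt.congr_deriv (f := fun t : ℝ => profile₁ k (regNorm ε (x + t • basisVec i)) *
      ((x + t • basisVec i) i : ℂ)) (HasDerivAt.mul h1 h2) ?_
    simp
  have c3 : ∀ i : Fin 3, Continuous (fun x : E3 =>
      profile₂ k (regNorm ε x) * x i * x i + profile₁ k (regNorm ε x)) := fun i =>
    ((c2.mul (hco i)).mul (hco i)).add c1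
  have key : ∀ i, ∫ x, profile k (regNorm ε x) * pderiv i (pderiv i φ) x
      = ∫ x, (profile₂ k (regNorm ε x) * x i * x i + profile₁ k (regNorm ε x)) * φ x := fun i =>
    integral_mul_pderiv_pderiv i c0 (c1.mul (hco i)) (c3 i) (hd1 i) (hd2 i) hφ hc
  have i1 : ∀ i, Integrable (fun x => profile k (regNorm ε x) * pderiv i (pderiv i φ) x) :=
    fun i => (c0.mul ((hφ.pderiv i).pderiv i).continuous).integrable_of_hasCompactSupport
      ((hc.pderiv i).pderiv i).mul_left
  have i2 : ∀ i : Fin 3, Integrable (fun x : E3 =>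
      (profile₂ k (regNorm ε x) * x i * x i + profile₁ k (regNorm ε x)) * φ x) :=
    fun i => ((c3 i).mul hφ.continuous).integrable_of_hasCompactSupport hc.mul_left
  have i3 : Integrable (fun x => profile k (regNorm ε x) * (k ^ 2 * φ x)) :=
    (c0.mul (continuous_const.mul hφ.continuous)).integrable_of_hasCompactSupport
      hc.mul_left.mul_left
  simp_rw [mul_add, Finset.mul_sum]
  rw [integral_add (integrable_finsetSum _ fun i _ => i1 i) i3,
    integral_finsetSum _ fun i _ => i1 i]
  simp_rw [key]
  rw [← integral_finsetSum _ fun i _ => i2 i, ← integral_add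
    (integrable_finsetSum _ fun i _ => i2 i) i3, ← integral_neg]
  congr 1
  ext x
  have h0 : (regNorm ε x : ℂ) ≠ 0 := by exact_mod_cast (regNorm_pos hε x).ne'
  have hsq : (x 0 : ℂ) ^ 2 + (x 1 : ℂ) ^ 2 + (x 2 : ℂ) ^ 2 = (regNorm ε x : ℂ) ^ 2 - ε ^ 2 := by
    have := regNorm_sq ε x
    rw [EuclideanSpace.norm_sq_eq, Fin.sum_univ_three] at this
    simp only [Real.norm_eq_abs, sq_abs] at this
    have h : x 0 ^ 2 + x 1 ^ 2 + x 2 ^ 2 = regNorm ε x ^ 2 - ε ^ 2 := by linarith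
    exact_mod_cast h
  rw [Fin.sum_univ_three]
  have h2 : ∀ s : ℂ, s ≠ 0 → ∀ e : ℂ,
      e * (-k ^ 2 * s ^ 2 - 3 * Complex.I * k * s + 3) / s ^ 5 * s ^ 2
      + 3 * (e * (Complex.I * k * s - 1) / s ^ 3) + e / s * k ^ 2 = 0 := by
    intro s hs e; field_simp; ring
  have h3 := h2 _ h0 (Complex.exp (Complex.I * k * (regNorm ε x)))
  have h4 : (profile₂ k (regNorm ε x)) * (regNorm ε x) ^ 2 + 3 * profile₁ k (regNorm ε x)
    + profile k (regNorm ε x) * k ^ 2 = 0 := h3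
  linear_combination (φ x) * h4 + (φ x) * profile₂ k (regNorm ε x) * hsq

lemma exists_isSource {ψ : E3 → ℂ} (h : Continuous ψ) (hc : HasCompactSupport ψ) :
    ∃ M R, IsSource ψ M R := by
  obtain ⟨M, hM⟩ := hc.exists_bound_of_continuous h
  obtain ⟨R, hR⟩ := hc.isCompact.isBounded.subset_ball (0 : E3)
  refine ⟨M, R, h.measurable, hM, fun y hy => ?_⟩
  by_contra hne
  have := hR (subset_tsupport _ (Function.mem_support.2 hne))
  simp at this
  linarith

lemma regNorm_zero (x : E3) : regNorm 0 x = ‖x‖ := by simp [regNorm]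

lemma norm_le_regNorm (ε : ℝ) (x : E3) : ‖x‖ ≤ regNorm ε x :=
  Real.le_sqrt_of_sq_le (by nlinarith [sq_nonneg ε])

lemma norm_profile (k s : ℝ) : ‖profile k s‖ = |s|⁻¹ := by
  simp [profile, norm_exp_I_mul_real]

lemma greens_eq_profile (k : ℝ) (x y : E3) :
    greens k x y = (4 * π : ℂ)⁻¹ * profile k ‖x - y‖ := by
  unfold greens profile; push_cast; rw [div_eq_mul_inv, mul_inv]; ring

lemma tendsto_integral_profile (k : ℝ) {ψ : E3 → ℂ} (h : Continuous ψ)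
    (hc : HasCompactSupport ψ) :
    Tendsto (fun ε : ℝ => ∫ x, profile k (regNorm ε x) * ψ x) (𝓝[>] 0)
      (𝓝 (∫ x, profile k ‖x‖ * ψ x)) := by
  obtain ⟨M, R, hs⟩ := exists_isSource h hc
  refine tendsto_integral_filter_of_dominated_convergence
    (fun x => 4 * π * ‖greens 0 0 x * ψ x‖) ?_ ?_ ((hs.integrable_greens 0 0).norm.const_mul _) ?_
  · filter_upwards [self_mem_nhdsWithin] with ε hε
    exact ((continuous_profile_comp k hε).1.mul h).aestronglyMeasurable
  · filter_upwards [self_mem_nhdsWithin] with ε hε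
    have h0 : ∀ᵐ x : E3, x ≠ 0 := by simp [ae_iff]
    filter_upwards [h0] with x hx
    have hx' : 0 < ‖x‖ := norm_pos_iff.2 hx
    rw [greens_eq_profile, norm_mul, norm_mul, norm_mul, norm_profile, norm_profile]
    have : (regNorm ε x)⁻¹ ≤ ‖x‖⁻¹ := inv_anti₀ hx' (norm_le_regNorm ε x)
    rw [abs_of_pos (regNorm_pos hε x)]
    have e : ‖(4 * π : ℂ)⁻¹‖ = (4 * π)⁻¹ := by simp [abs_of_pos Real.pi_pos]
    rw [e, zero_sub, norm_neg, abs_of_pos hx']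
    have hp := Real.pi_pos
    calc _ ≤ ‖x‖⁻¹ * ‖ψ x‖ := by gcongr
      _ = _ := by field_simp
  · have h0 : ∀ᵐ x : E3, x ≠ 0 := by simp [ae_iff]
    filter_upwards [h0] with x hx
    have hx' : 0 < ‖x‖ := norm_pos_iff.2 hx
    have h1 : Tendsto (fun ε : ℝ => regNorm ε x) (𝓝[>] 0) (𝓝 ‖x‖) := by
      have : Continuous (fun ε : ℝ => regNorm ε x) := by unfold regNorm; fun_prop
      simpa [regNorm_zero] using (this.tendsto 0).mono_left nhdsWithin_le_nhds
    exact ((hasDerivAt_profile k hx').continuousAt.tendsto.comp h1).mul_const _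

lemma integrable_regNorm_one : Integrable (fun z : E3 => (regNorm 1 z ^ 5)⁻¹) := by
  have := integrable_rpow_neg_one_add_norm_sq (E := E3) (μ := volume) (r := 5)
    (by simp; norm_num)
  refine this.congr (ae_of_all _ fun z => ?_)
  simp only [regNorm, one_pow]
  rw [neg_div, Real.rpow_neg (by positivity), Real.rpow_div_two_eq_sqrt _ (by positivity),
    add_comm]
  norm_cast

lemma integral_regNorm_one : ∫ z : E3, (regNorm 1 z ^ 5)⁻¹ = 4 * π / 3 := by
  have h := integral_fun_norm_addHaar (E := E3) volume (fun y : ℝ => (√(y ^ 2 + 1 ^ 2) ^ 5)⁻¹)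
  have hi := (integrable_fun_norm_addHaar (E := E3) volume
    (f := fun y : ℝ => (√(y ^ 2 + 1 ^ 2) ^ 5)⁻¹)).1 integrable_regNorm_one
  rw [show (fun z : E3 => (regNorm 1 z ^ 5)⁻¹) = fun z : E3 => (√(‖z‖ ^ 2 + 1 ^ 2) ^ 5)⁻¹ from rfl,
    h]
  have hd : ∀ y ∈ Set.Ici (0 : ℝ), HasDerivAt (fun y : ℝ => (y / √(y ^ 2 + 1 ^ 2)) ^ 3 / 3)
      (y ^ 2 • (√(y ^ 2 + 1 ^ 2) ^ 5)⁻¹) y := by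
    intro y _
    have hpos : 0 < y ^ 2 + 1 ^ 2 := by positivity
    have h1 : HasDerivAt (fun y : ℝ => y ^ 2 + 1 ^ 2) (2 * y) y := by
      simpa using ((hasDerivAt_id y).pow 2).add_const ((1 : ℝ) ^ 2)
    have h2 := h1.sqrt hpos.ne'
    have hs : 0 < √(y ^ 2 + 1 ^ 2) := Real.sqrt_pos.2 hpos
    refine ((((hasDerivAt_id y).div h2 hs.ne').pow 3).div_const 3).congr_deriv ?_
    have hsq := Real.sq_sqrt hpos.le
    simp only [id, smul_eq_mul, Pi.div_apply]
    set s := √(y ^ 2 + 1 ^ 2)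
    have e : 1 * s - y * (2 * y / (2 * s)) = 1 / s := by field_simp; linarith
    rw [e]
    field_simp
    norm_num
    field_simp
  have hlim : Tendsto (fun y : ℝ => (y / √(y ^ 2 + 1 ^ 2)) ^ 3 / 3) atTop (𝓝 (1 / 3)) := by
    have h1 : Tendsto (fun y : ℝ => (√(1 + (y⁻¹) ^ 2))⁻¹) atTop (𝓝 1) := by
      have : Tendsto (fun y : ℝ => (√(1 + (y⁻¹) ^ 2))⁻¹) atTop (𝓝 ((√(1 + (0 : ℝ) ^ 2))⁻¹)) := by
        refine Tendsto.inv₀ ?_ (by simp)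
        refine (Real.continuous_sqrt.tendsto _).comp ?_
        exact (tendsto_inv_atTop_zero.pow 2).const_add 1
      simpa using this
    have h2 : Tendsto (fun y : ℝ => y / √(y ^ 2 + 1 ^ 2)) atTop (𝓝 1) := by
      refine h1.congr' ?_
      filter_upwards [eventually_gt_atTop 0] with y hy
      have : y ^ 2 + 1 ^ 2 = y ^ 2 * (1 + (y⁻¹) ^ 2) := by field_simp
      rw [this, Real.sqrt_mul (by positivity), Real.sqrt_sq hy.le]
      field_simp
    simpa using (h2.pow 3).div_const 3
  have hfr : Module.finrank ℝ E3 - 1 = 2 := by simp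
  rw [hfr] at hi
  rw [hfr, integral_Ioi_of_hasDerivAt_of_tendsto' hd hi hlim, Measure.real,
    InnerProductSpace.volume_ball_of_dim_odd (k := 1) (by simp)]
  simp [Nat.doubleFactorial]
  rw [ENNReal.toReal_ofReal (by positivity)]
  ring

lemma tendsto_integral_profile₂ (k : ℝ) {φ : E3 → ℂ} (h : Continuous φ)
    (hc : HasCompactSupport φ) :
    Tendsto (fun ε : ℝ => ∫ x, ε ^ 2 * profile₂ k (regNorm ε x) * φ x) (𝓝[>] 0)
      (𝓝 (4 * π * φ 0)) := by
  obtain ⟨M, R, hs⟩ := exists_isSource h hc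
  have hscale : ∀ ε : ℝ, 0 < ε → ∀ z : E3, regNorm ε (ε • z) = ε * regNorm 1 z := by
    intro ε hε z
    unfold regNorm
    rw [norm_smul, Real.norm_of_nonneg hε.le,
      show (ε * ‖z‖) ^ 2 + ε ^ 2 = ε ^ 2 * (‖z‖ ^ 2 + 1 ^ 2) by ring,
      Real.sqrt_mul (by positivity), Real.sqrt_sq hε.le]
  set F : ℝ → E3 → ℂ := fun ε z => Complex.exp (Complex.I * k * (ε * regNorm 1 z : ℝ)) *
    (-k ^ 2 * (ε * regNorm 1 z) ^ 2 - 3 * Complex.I * k * (ε * regNorm 1 z) + 3) *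
      ((regNorm 1 z ^ 5)⁻¹ : ℝ) * φ (ε • z) with hF
  have hchange : ∀ ε : ℝ, 0 < ε →
      ∫ z, F ε z = ∫ x, ε ^ 2 * profile₂ k (regNorm ε x) * φ x := by
    intro ε hε
    have h1 := Measure.integral_comp_smul (volume : Measure E3)
      (fun x => ε ^ 2 * profile₂ k (regNorm ε x) * φ x) ε
    have h2 : ∀ z : E3, F ε z = (ε ^ 3 : ℝ) • ((ε : ℂ) ^ 2 * profile₂ k (regNorm ε (ε • z)) *
        φ (ε • z)) := by
      intro z
      rw [hscale ε hε]
      simp only [hF, profile₂, Complex.real_smul]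
      have : (regNorm 1 z : ℂ) ≠ 0 := by exact_mod_cast (regNorm_pos one_pos z).ne'
      have : (ε : ℂ) ≠ 0 := by exact_mod_cast hε.ne'
      push_cast
      field_simp
    simp_rw [h2]
    rw [integral_smul, h1, smul_smul, finrank_euclideanSpace_fin, abs_of_pos (by positivity),
      mul_inv_cancel₀ (by positivity), one_smul]
  have hlim : ∫ z, 3 * ((regNorm 1 z ^ 5)⁻¹ : ℝ) * φ 0 = 4 * π * φ 0 := by
    rw [integral_mul_const, integral_const_mul, integral_complex_ofReal, integral_regNorm_one]
    push_cast; ring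
  rw [← hlim]
  refine Tendsto.congr' (f₁ := fun ε => ∫ z, F ε z)
    (by filter_upwards [self_mem_nhdsWithin] with ε hε using hchange ε hε) ?_
  set S := |R| + 1
  refine tendsto_integral_filter_of_dominated_convergence
    (fun z => (k ^ 2 * S ^ 2 + 3 * |k| * S + 3) * M * (regNorm 1 z ^ 5)⁻¹) ?_ ?_
    (integrable_regNorm_one.const_mul _) ?_
  · filter_upwards [self_mem_nhdsWithin] with ε hε
    have c1 := continuous_regNorm 1
    have : Continuous fun z : E3 => (regNorm 1 z ^ 5)⁻¹ :=
      (c1.pow 5).inv₀ fun z => (pow_pos (regNorm_pos one_pos z) 5).ne'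
    have c2 := Complex.continuous_ofReal.comp this
    have c3 : Continuous fun z : E3 => φ (ε • z) := h.comp (by fun_prop)
    refine Continuous.aestronglyMeasurable ?_
    exact Continuous.mul (Continuous.mul (by fun_prop) c2) c3
  · filter_upwards [Ioc_mem_nhdsGT (one_pos (α := ℝ))] with ε hε
    refine ae_of_all _ fun z => ?_
    have hr := regNorm_pos one_pos z
    simp only [hF, norm_mul, norm_exp_I_mul_real, one_mul, Complex.norm_real]
    rw [Real.norm_of_nonneg (by positivity)]
    by_cases hz : R ≤ ‖ε • z‖
    · rw [hs.supp _ hz]; simp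
      have := hs.nonneg
      positivity
    · have hεr : ε * regNorm 1 z ≤ S := by
        rw [← hscale ε hε.1]
        push Not at hz
        refine Real.sqrt_le_iff.2 ⟨by positivity, ?_⟩
        have h1 : ‖ε • z‖ ≤ |R| := hz.le.trans (le_abs_self R)
        have h2 := hε.1
        have h3 := hε.2
        nlinarith [norm_nonneg (ε • z), abs_nonneg R]
      set t : ℝ := ε * regNorm 1 z with ht
      have ht0 : 0 ≤ t := mul_nonneg hε.1.le hr.le
      have h1 : ‖-(k : ℂ) ^ 2 * (ε * regNorm 1 z) ^ 2 - 3 * Complex.I * k * (ε * regNorm 1 z) + 3‖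
          ≤ k ^ 2 * S ^ 2 + 3 * |k| * S + 3 := by
        rw [show (ε : ℂ) * regNorm 1 z = (t : ℂ) by rw [ht]; push_cast; rfl]
        refine (norm_add_le _ _).trans ?_
        refine add_le_add ((norm_sub_le _ _).trans (add_le_add ?_ ?_)) (by simp)
        · simp [abs_of_nonneg ht0]; gcongr
        · simp [abs_of_nonneg ht0]; gcongr
      have h2 := hs.bound (ε • z)
      have h3 : 0 < (regNorm 1 z ^ 5)⁻¹ := by positivity
      calc _ ≤ (k ^ 2 * S ^ 2 + 3 * |k| * S + 3) * (regNorm 1 z ^ 5)⁻¹ * M := by gcongr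
        _ = _ := by ring
  · refine ae_of_all _ fun z => ?_
    have c1 : Continuous fun ε : ℝ => F ε z := by
      have c3 : Continuous fun ε : ℝ => φ (ε • z) := h.comp (by fun_prop)
      refine Continuous.mul (Continuous.mul (by fun_prop) (by fun_prop)) c3
    have := (c1.tendsto 0).mono_left (nhdsWithin_le_nhds (s := Set.Ioi 0))
    simpa [hF] using this


theorem integral_greens_helmholtz (k : ℝ) {φ : E3 → ℂ} (hφ : ContDiff ℝ (⊤ : ℕ∞) φ)
    (hc : HasCompactSupport φ) (y : E3) :
    ∫ x, greens k x y * (∑ i, pderiv i (pderiv i φ) x + k ^ 2 * φ x) = - φ y := by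
  wlog hy : y = 0 generalizing φ y
  · have hφ' : ContDiff ℝ (⊤ : ℕ∞) (fun x => φ (x + y)) := hφ.comp (by fun_prop)
    have hc' : HasCompactSupport (fun x => φ (x + y)) := by
      simpa [Function.comp_def] using hc.comp_homeomorph (Homeomorph.addRight y)
    have h := this hφ' hc' 0 rfl
    have hp : ∀ i (f : E3 → ℂ), pderiv i (fun x => f (x + y)) = fun x => pderiv i f (x + y) := by
      intro i f; ext x; simp only [pderiv, fderiv_comp_add_right]
    simp only [hp, zero_add] at h
    rw [← h, ← integral_add_right_eq_self _ y]
    simp [greens]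
  · subst hy
    have hψ : Continuous fun x => ∑ i, pderiv i (pderiv i φ) x + k ^ 2 * φ x :=
      (continuous_finsetSum _ fun i _ => ((hφ.pderiv i).pderiv i).continuous).add
        (continuous_const.mul hφ.continuous)
    have hψc : HasCompactSupport fun x => ∑ i, pderiv i (pderiv i φ) x + k ^ 2 * φ x := by
      refine HasCompactSupport.add (f := fun x => ∑ i, pderiv i (pderiv i φ) x) ?_ hc.mul_left
      simp only [Fin.sum_univ_three]
      exact (((hc.pderiv 0).pderiv 0).add ((hc.pderiv 1).pderiv 1)).add ((hc.pderiv 2).pderiv 2)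
    have h1 := tendsto_integral_profile k hψ hψc
    have h2 := (tendsto_integral_profile₂ k hφ.continuous hc).neg
    have h3 := tendsto_nhds_unique h1 (h2.congr' (by
      filter_upwards [self_mem_nhdsWithin] with ε hε using
        (integral_regularized k hε hφ hc).symm))
    simp only [greens_eq_profile, sub_zero, mul_assoc]
    rw [integral_const_mul, h3]
    have : (π : ℂ) ≠ 0 := by exact_mod_cast Real.pi_ne_zero
    field_simp

/-- The complex plane wave `exp (-i c · x)`. -/
def planeWave (c : Fin 3 → ℂ) (x : E3) : ℂ :=
  Complex.exp (-Complex.I * ∑ i, c i * (x i : ℝ))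

lemma contDiff_planeWave (c : Fin 3 → ℂ) : ContDiff ℝ (⊤ : ℕ∞) (planeWave c) := by
  unfold planeWave
  have hco : ∀ i : Fin 3, ContDiff ℝ (⊤ : ℕ∞) (fun x : E3 => ((x i : ℝ) : ℂ)) := fun i =>
    Complex.ofRealCLM.contDiff.comp (EuclideanSpace.proj (𝕜 := ℝ) i : E3 →L[ℝ] ℝ).contDiff
  exact (contDiff_const.mul (ContDiff.sum fun i _ => contDiff_const.mul (hco i))).cexp

lemma continuous_planeWave (c : Fin 3 → ℂ) : Continuous (planeWave c) :=
  (contDiff_planeWave c).continuous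

lemma exists_norm_planeWave_le (c : Fin 3 → ℂ) (r : ℝ) :
    ∃ C, ∀ x : E3, ‖x‖ < r → ‖planeWave c x‖ ≤ C := by
  obtain ⟨C, hC⟩ := (isCompact_closedBall (0 : E3) r).exists_bound_of_continuousOn
    (continuous_planeWave c).continuousOn
  exact ⟨C, fun x hx => hC x (by simpa using hx.le)⟩

lemma pderiv_planeWave (c : Fin 3 → ℂ) (i : Fin 3) :
    pderiv i (planeWave c) = fun x => (-Complex.I * c i) * planeWave c x := by
  ext x
  have h1 := (contDiff_planeWave c).hasLineDerivAt_pderiv i x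
  have h2 : HasLineDerivAt ℝ (planeWave c) ((-Complex.I * c i) * planeWave c x) x
      (basisVec i) := by
    unfold HasLineDerivAt planeWave
    have : ∀ j : Fin 3, HasDerivAt
        (fun t : ℝ => c j * (((x + t • basisVec i) j : ℝ) : ℂ)) (if j = i then c i else 0) 0 := by
      intro j
      have h3 : HasDerivAt (fun t : ℝ => (x + t • basisVec i) j) (if j = i then 1 else 0) 0 := by
        have := (((hasDerivAt_id (0 : ℝ)).mul_const (basisVec i j))).const_add (x j)
        simpa [basisVec, Pi.single_apply] using this
      refine (h3.ofReal_comp.const_mul (c j)).congr_deriv ?_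
      split_ifs with h <;> simp [h]
    have h4 := (HasDerivAt.fun_sum (u := Finset.univ) fun j _ => this j)
    refine (h4.const_mul (-Complex.I)).cexp.congr_deriv ?_
    simp
    ring
  exact h1.lineDeriv.symm.trans h2.lineDeriv

theorem IsSource.integral_potential_planeWave {q : E3 → ℂ} {M R : ℝ} (h : IsSource q M R)
    (k : ℝ) {ρ : ℝ} (hρ : ∀ x, ρ ≤ ‖x‖ → potential k q x = 0) (c : Fin 3 → ℂ) :
    (∑ i, c i ^ 2 - k ^ 2) * ∫ x, planeWave c x * potential k q x
      = ∫ y, planeWave c y * q y := by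
  set r := |ρ| + |R| + 1 with hr
  have hr0 : 0 < r := by positivity
  let χ : ContDiffBump (0 : E3) := ⟨r, r + 1, hr0, by linarith⟩
  set φ : E3 → ℂ := fun x => (χ x : ℂ) * planeWave c x with hφdef
  have hφ : ContDiff ℝ (⊤ : ℕ∞) φ :=
    (Complex.ofRealCLM.contDiff.comp χ.contDiff).mul (contDiff_planeWave c)
  have hφc : HasCompactSupport φ := by
    refine HasCompactSupport.mul_right ?_
    exact χ.hasCompactSupport.comp_left (g := fun t : ℝ => (t : ℂ)) (by simp)
  have hφ1 : ∀ x : E3, ‖x‖ < r → φ =ᶠ[𝓝 x] planeWave c := by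
    intro x hx
    filter_upwards [Metric.isOpen_ball.mem_nhds (show x ∈ Metric.ball (0 : E3) r by simpa using hx)]
      with z hz
    have : χ z = 1 := χ.one_of_mem_closedBall (Metric.ball_subset_closedBall hz)
    simp [hφdef, this]
  have hcongr : ∀ (f g : E3 → ℂ) (i : Fin 3) (x : E3), f =ᶠ[𝓝 x] g →
      pderiv i f =ᶠ[𝓝 x] pderiv i g := by
    intro f g i x hfg
    filter_upwards [hfg.fderiv (𝕜 := ℝ)] with z hz
    simp [pderiv, hz]
  set ψ : E3 → ℂ := fun x => ∑ i, pderiv i (pderiv i φ) x + k ^ 2 * φ x with hψdef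
  have hψ1 : ∀ x : E3, ‖x‖ < r → ψ x = -((∑ i, c i ^ 2 - k ^ 2) * planeWave c x) := by
    intro x hx
    have e : ∀ i, pderiv i (pderiv i φ) x = (-Complex.I * c i) ^ 2 * planeWave c x := by
      intro i
      rw [(hcongr _ _ i x (hcongr _ _ i x (hφ1 x hx))).eq_of_nhds, pderiv_planeWave]
      have : pderiv i (fun x => -Complex.I * c i * planeWave c x) x
          = -Complex.I * c i * pderiv i (planeWave c) x := by
        unfold pderiv
        rw [fderiv_const_mul ((contDiff_planeWave c).differentiable (by simp) x)]
        simp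
      rw [this, pderiv_planeWave]; ring
    simp only [hψdef, e, (hφ1 x hx).eq_of_nhds, mul_pow, neg_sq, Complex.I_sq]
    rw [← Finset.sum_mul, ← Finset.mul_sum]
    ring
  have hψc : HasCompactSupport ψ := by
    refine HasCompactSupport.add (f := fun x => ∑ i, pderiv i (pderiv i φ) x) ?_ hφc.mul_left
    simp only [Fin.sum_univ_three]
    exact (((hφc.pderiv 0).pderiv 0).add ((hφc.pderiv 1).pderiv 1)).add
      ((hφc.pderiv 2).pderiv 2)
  have hψcont : Continuous ψ :=
    (continuous_finsetSum _ fun i _ => ((hφ.pderiv i).pderiv i).continuous).add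
      (continuous_const.mul hφ.continuous)
  have h1 : ∫ x, ψ x * potential k q x
      = -((∑ i, c i ^ 2 - k ^ 2) * ∫ x, planeWave c x * potential k q x) := by
    rw [← integral_const_mul, ← integral_neg]
    congr 1
    ext x
    by_cases hx : ‖x‖ < r
    · rw [hψ1 x hx]; ring
    · rw [hρ x (by have := le_abs_self ρ; have := abs_nonneg R; linarith)]; simp
  have h2 : ∫ x, ψ x * potential k q x = - ∫ y, planeWave c y * q y := by
    have hmul := h.integrable_prod k (hψcont.integrable_of_hasCompactSupport hψc)
    calc ∫ x, ψ x * potential k q x = ∫ x, ∫ y, ψ x * (greens k x y * q y) := by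
          simp only [potential, integral_const_mul]
      _ = ∫ y, ∫ x, ψ x * (greens k x y * q y) := integral_integral_swap hmul
      _ = ∫ y, -(planeWave c y * q y) := by
          congr 1
          ext y
          have : ∀ x, ψ x * (greens k x y * q y) = (greens k x y * ψ x) * q y := fun x => by ring
          simp only [this]
          rw [integral_mul_const, integral_greens_helmholtz k hφ hφc y]
          by_cases hy : ‖y‖ < r
          · rw [(hφ1 y hy).eq_of_nhds]; ring
          · rw [h.supp y (by have := le_abs_self R; have := abs_nonneg ρ; linarith)]; simp
      _ = _ := integral_neg _
  rw [h1] at h2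
  exact neg_injective h2

/-- The profile, in cylindrical coordinates, of a zonal function of the direction `x / ‖x‖`
restricted to the unit ball. -/
def zonal (a t s : ℝ) : ℂ :=
  if t ^ 2 + s < 1 then Complex.exp (Complex.I * ((a * (t / √(t ^ 2 + s)) : ℝ) : ℂ)) else 0

lemma measurable_zonal (a : ℝ) : Measurable fun z : ℝ × ℝ => zonal a z.1 z.2 := by
  unfold zonal
  refine Measurable.ite (measurableSet_lt (by fun_prop) measurable_const) ?_ measurable_const
  refine Complex.measurable_exp.comp (measurable_const.mul (Complex.measurable_ofReal.comp ?_))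
  exact measurable_const.mul (measurable_fst.div
    (((measurable_fst.pow_const 2).add measurable_snd).sqrt))

lemma norm_zonal_le (a t s : ℝ) : ‖zonal a t s‖ ≤ 1 := by
  unfold zonal
  split_ifs
  · rw [mul_comm, Complex.norm_exp_ofReal_mul_I]
  · simp

lemma integral_sin_mul_exp_cos (a : ℝ) :
    ∫ θ in (0 : ℝ)..π, ((sin θ : ℝ) : ℂ) * Complex.exp (Complex.I * ((a * cos θ : ℝ) : ℂ))
      = 2 * (sinc a : ℂ) := by
  by_cases ha : a = 0
  · subst ha
    simp only [zero_mul, Complex.ofReal_zero, mul_zero, Complex.exp_zero, mul_one, sinc_zero]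
    rw [intervalIntegral.integral_ofReal, integral_sin]
    norm_num
  · have haC : (a : ℂ) ≠ 0 := by exact_mod_cast ha
    have hd : ∀ θ : ℝ, HasDerivAt
        (fun θ : ℝ => Complex.I / a * Complex.exp (Complex.I * ((a * cos θ : ℝ) : ℂ)))
        (((sin θ : ℝ) : ℂ) * Complex.exp (Complex.I * ((a * cos θ : ℝ) : ℂ))) θ := by
      intro θ
      have h1 := ((((hasDerivAt_cos θ).const_mul a).ofReal_comp).const_mul Complex.I).cexp.const_mul
        (Complex.I / a)
      refine h1.congr_deriv ?_
      push_cast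
      field_simp
      rw [show Complex.I ^ 2 = -1 from Complex.I_sq]
      ring
    rw [intervalIntegral.integral_eq_sub_of_hasDerivAt (fun θ _ => hd θ)
      (Continuous.intervalIntegrable (by fun_prop) _ _)]
    rw [sinc_of_ne_zero ha]
    push_cast
    rw [Complex.cos_pi, Complex.cos_zero]
    rw [Complex.sin]
    field_simp

lemma integral_zonal_half_plane (a : ℝ) :
    ∫ z : ℝ × ℝ, (if 0 < z.2 then (z.2 : ℂ) * zonal a z.1 (z.2 ^ 2) else 0)
      = 2 / 3 * (sinc a : ℂ) := by
  rw [← integral_comp_polarCoord_symm]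
  have key : ∀ p ∈ polarCoord.target,
      p.1 • (fun z : ℝ × ℝ => if 0 < z.2 then (z.2 : ℂ) * zonal a z.1 (z.2 ^ 2) else 0)
        (polarCoord.symm p)
      = (fun r : ℝ => if r < 1 then ((r ^ 2 : ℝ) : ℂ) else 0) p.1 *
        (fun θ : ℝ => if 0 < θ then
          ((sin θ : ℝ) : ℂ) * Complex.exp (Complex.I * ((a * cos θ : ℝ) : ℂ)) else 0) p.2 := by
    rintro ⟨r, θ⟩ ⟨hr, hθ⟩
    simp only [Set.mem_Ioi, Set.mem_Ioo] at hr hθ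
    have hsum : (r * cos θ) ^ 2 + (r * sin θ) ^ 2 = r ^ 2 := by
      nlinarith [sin_sq_add_cos_sq θ]
    have hpos : 0 < r * sin θ ↔ 0 < θ := by
      rw [mul_pos_iff_of_pos_left hr]
      constructor
      · intro h
        by_contra! h'
        linarith [sin_nonpos_of_nonpos_of_neg_pi_le h' hθ.1.le]
      · exact fun h => sin_pos_of_pos_of_lt_pi h hθ.2
    have hlt : r ^ 2 < 1 ↔ r < 1 := by rw [sq_lt_one_iff₀ hr.le]
    simp only [polarCoord_symm_apply, hpos, zonal, hsum, hlt, sqrt_sq hr.le,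
      mul_div_cancel_left₀ _ hr.ne']
    by_cases h1 : 0 < θ <;> by_cases h2 : r < 1 <;> simp [h1, h2]
    ring
  rw [setIntegral_congr_fun polarCoord.open_target.measurableSet key]
  have ht : polarCoord.target = Set.Ioi (0 : ℝ) ×ˢ Set.Ioo (-π) π := rfl
  rw [ht, Measure.volume_eq_prod]
  refine (setIntegral_prod_mul (fun r : ℝ => if r < 1 then ((r ^ 2 : ℝ) : ℂ) else 0)
    (fun θ : ℝ => if 0 < θ then
      ((sin θ : ℝ) : ℂ) * Complex.exp (Complex.I * ((a * cos θ : ℝ) : ℂ)) else 0) _ _).trans ?_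
  have e1 : ∫ r in Set.Ioi (0 : ℝ), (if r < 1 then ((r ^ 2 : ℝ) : ℂ) else 0) = 1 / 3 := by
    have : (fun r : ℝ => if r < 1 then ((r ^ 2 : ℝ) : ℂ) else 0)
        = (Set.Iio (1 : ℝ)).indicator fun r => ((r ^ 2 : ℝ) : ℂ) := by
      ext r; simp [Set.indicator]
    rw [this, setIntegral_indicator measurableSet_Iio, Set.Ioi_inter_Iio,
      ← integral_Ioc_eq_integral_Ioo, ← intervalIntegral.integral_of_le zero_le_one,
      intervalIntegral.integral_ofReal, integral_pow]
    norm_num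
  have e2 : ∫ θ in Set.Ioo (-π) π, (if 0 < θ then
      ((sin θ : ℝ) : ℂ) * Complex.exp (Complex.I * ((a * cos θ : ℝ) : ℂ)) else 0)
        = 2 * (sinc a : ℂ) := by
    have : (fun θ : ℝ => if 0 < θ then
        ((sin θ : ℝ) : ℂ) * Complex.exp (Complex.I * ((a * cos θ : ℝ) : ℂ)) else 0)
        = (Set.Ioi (0 : ℝ)).indicator fun θ =>
          ((sin θ : ℝ) : ℂ) * Complex.exp (Complex.I * ((a * cos θ : ℝ) : ℂ)) := by
      ext r; simp [Set.indicator]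
    rw [this, setIntegral_indicator measurableSet_Ioi]
    have hs : Set.Ioo (-π) π ∩ Set.Ioi 0 = Set.Ioo 0 π := by
      ext x; simp only [Set.mem_inter_iff, Set.mem_Ioo, Set.mem_Ioi]
      constructor
      · rintro ⟨⟨h1, h2⟩, h3⟩; exact ⟨h3, h2⟩
      · rintro ⟨h1, h2⟩; exact ⟨⟨by linarith [pi_pos], h2⟩, h1⟩
    rw [hs, ← integral_Ioc_eq_integral_Ioo, ← intervalIntegral.integral_of_le pi_pos.le,
      integral_sin_mul_exp_cos]
  rw [e1, e2]
  ring

lemma integral_zonal_plane (a t : ℝ) :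
    ∫ z : ℝ × ℝ, zonal a t (z.1 ^ 2 + z.2 ^ 2)
      = 2 * π * ∫ ρ : ℝ, (if 0 < ρ then (ρ : ℂ) * zonal a t (ρ ^ 2) else 0) := by
  rw [← integral_comp_polarCoord_symm]
  have key : ∀ p ∈ polarCoord.target,
      p.1 • (fun z : ℝ × ℝ => zonal a t (z.1 ^ 2 + z.2 ^ 2)) (polarCoord.symm p)
      = (fun ρ : ℝ => (ρ : ℂ) * zonal a t (ρ ^ 2)) p.1 * (fun _ : ℝ => (1 : ℂ)) p.2 := by
    rintro ⟨r, θ⟩ -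
    have hsum : (r * cos θ) ^ 2 + (r * sin θ) ^ 2 = r ^ 2 := by
      nlinarith [sin_sq_add_cos_sq θ]
    simp only [polarCoord_symm_apply, hsum, mul_one, Complex.real_smul]
  rw [setIntegral_congr_fun polarCoord.open_target.measurableSet key]
  have ht : polarCoord.target = Set.Ioi (0 : ℝ) ×ˢ Set.Ioo (-π) π := rfl
  rw [ht, Measure.volume_eq_prod]
  refine (setIntegral_prod_mul (fun ρ : ℝ => (ρ : ℂ) * zonal a t (ρ ^ 2))
    (fun _ : ℝ => (1 : ℂ)) _ _).trans ?_
  rw [← integral_indicator measurableSet_Ioi]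
  have : (∫ _ in Set.Ioo (-π) π, (1 : ℂ)) = 2 * π := by
    rw [← integral_Ioc_eq_integral_Ioo, ← intervalIntegral.integral_of_le (by linarith [pi_pos])]
    simp; ring
  rw [this, mul_comm]
  rfl

lemma integral_zonal (a : ℝ) :
    ∫ z : ℝ × ℝ × ℝ, zonal a z.1 (z.2.1 ^ 2 + z.2.2 ^ 2) = 4 * π / 3 * (sinc a : ℂ) := by
  have hm3 : Measurable fun z : ℝ × ℝ × ℝ => zonal a z.1 (z.2.1 ^ 2 + z.2.2 ^ 2) :=
    (measurable_zonal a).comp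
      (by fun_prop : Measurable fun z : ℝ × ℝ × ℝ => (z.1, z.2.1 ^ 2 + z.2.2 ^ 2))
  have hi3 : Integrable fun z : ℝ × ℝ × ℝ => zonal a z.1 (z.2.1 ^ 2 + z.2.2 ^ 2) := by
    refine Integrable.mono' (g := (Set.Icc (-1 : ℝ) 1 ×ˢ Set.Icc (-1 : ℝ) 1 ×ˢ
      Set.Icc (-1 : ℝ) 1).indicator fun _ => (1 : ℝ)) ?_ hm3.aestronglyMeasurable
      (Eventually.of_forall fun z => ?_)
    · refine (integrable_indicator_iff (measurableSet_Icc.prod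
        (measurableSet_Icc.prod measurableSet_Icc))).2 ?_
      exact continuousOn_const.integrableOn_compact
        (isCompact_Icc.prod (isCompact_Icc.prod isCompact_Icc))
    · by_cases h : z.1 ^ 2 + (z.2.1 ^ 2 + z.2.2 ^ 2) < 1
      · rw [Set.indicator_of_mem]
        · exact norm_zonal_le _ _ _
        · refine ⟨?_, ?_, ?_⟩ <;> constructor <;> nlinarith [sq_nonneg z.1, sq_nonneg z.2.1, sq_nonneg z.2.2]
      · simp only [zonal, h, if_false, norm_zero]
        exact Set.indicator_nonneg (fun _ _ => zero_le_one) _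
  have hm2 : Measurable fun z : ℝ × ℝ =>
      (if 0 < z.2 then (z.2 : ℂ) * zonal a z.1 (z.2 ^ 2) else 0) := by
    refine Measurable.ite (measurableSet_lt measurable_const measurable_snd) ?_ measurable_const
    exact (Complex.measurable_ofReal.comp measurable_snd).mul ((measurable_zonal a).comp
      (by fun_prop : Measurable fun z : ℝ × ℝ => (z.1, z.2 ^ 2)))
  have hi2 : Integrable fun z : ℝ × ℝ =>
      (if 0 < z.2 then (z.2 : ℂ) * zonal a z.1 (z.2 ^ 2) else 0) := by
    refine Integrable.mono' (g := (Set.Icc (-1 : ℝ) 1 ×ˢ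
      Set.Icc (-1 : ℝ) 1).indicator fun _ => (1 : ℝ)) ?_ hm2.aestronglyMeasurable
      (Eventually.of_forall fun z => ?_)
    · refine (integrable_indicator_iff (measurableSet_Icc.prod measurableSet_Icc)).2 ?_
      exact continuousOn_const.integrableOn_compact (isCompact_Icc.prod isCompact_Icc)
    · by_cases h : z.1 ^ 2 + z.2 ^ 2 < 1
      · have hz1 : |z.1| ≤ 1 := abs_le_of_sq_le_sq (by nlinarith [sq_nonneg z.2]) zero_le_one
        have hz2 : |z.2| ≤ 1 := abs_le_of_sq_le_sq (by nlinarith [sq_nonneg z.1]) zero_le_one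
        rw [Set.indicator_of_mem (show z ∈ Set.Icc (-1 : ℝ) 1 ×ˢ Set.Icc (-1 : ℝ) 1 from
          ⟨abs_le.1 hz1, abs_le.1 hz2⟩)]
        split_ifs
        · rw [norm_mul, Complex.norm_real, Real.norm_eq_abs]
          exact mul_le_one₀ hz2 (norm_nonneg _) (norm_zonal_le _ _ _)
        · simp
      · simp only [zonal, h, if_false, mul_zero, ite_self, norm_zero]
        exact Set.indicator_nonneg (fun _ _ => zero_le_one) _
  rw [Measure.volume_eq_prod, integral_prod _ hi3]
  simp only [integral_zonal_plane]
  rw [integral_const_mul, ← integral_prod (fun z : ℝ × ℝ =>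
      (if 0 < z.2 then (z.2 : ℂ) * zonal a z.1 (z.2 ^ 2) else 0)) hi2, ← Measure.volume_eq_prod,
    integral_zonal_half_plane]
  ring

lemma integral_eq_integral_coords (F : ℝ → ℝ → ℝ → ℂ) :
    ∫ x : E3, F (x 0) (x 1) (x 2) = ∫ z : ℝ × ℝ × ℝ, F z.1 z.2.1 z.2.2 := by
  have h1 := (EuclideanSpace.volume_preserving_symm_measurableEquiv_toLp (Fin 3))
  have h2 := (volume_preserving_piFinSuccAbove (fun _ : Fin 3 => ℝ) 0)
  have h3 := (MeasurePreserving.id (volume : Measure ℝ)).prod (volume_preserving_finTwoArrow ℝ)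
  have e3 := h3.integral_comp (g := fun z : ℝ × ℝ × ℝ => F z.1 z.2.1 z.2.2)
    (((MeasurableEquiv.refl ℝ).prodCongr MeasurableEquiv.finTwoArrow).measurableEmbedding)
  have e2 := h2.integral_comp' (g := fun z : ℝ × (Fin 2 → ℝ) => F z.1 (z.2 0) (z.2 1))
  have e1 := h1.integral_comp' (g := fun z : Fin 3 → ℝ => F (z 0) (z 1) (z 2))
  exact e1.trans (e2.trans e3)

/-- The mean of the plane waves `exp (i k ω · z)` over all directions `ω` is `sinc (k ‖z‖)`. -/
lemma integral_ball_exp_direction (k : ℝ) (z : E3) :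
    ∫ x in Metric.ball (0 : E3) 1,
      Complex.exp (Complex.I * ((k * (inner ℝ x z / ‖x‖) : ℝ) : ℂ))
      = 4 * π / 3 * (sinc (k * ‖z‖) : ℂ) := by
  set e : E3 := EuclideanSpace.single 0 ‖z‖ with he
  have hne : ‖e‖ = ‖z‖ := by simp [he]
  set A := (Submodule.span ℝ {e - z})ᗮ.reflection with hA
  have hAe : A e = z := Submodule.reflection_sub hne
  have hAz : ∀ x, inner ℝ (A x) z = inner ℝ x e := fun x => by
    rw [← hAe, LinearIsometryEquiv.inner_map_map]
  rw [← integral_indicator Metric.isOpen_ball.measurableSet,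
    ← A.measurePreserving.integral_comp A.toHomeomorph.measurableEmbedding]
  rw [← integral_zonal, ← integral_eq_integral_coords
    (fun t a b => zonal (k * ‖z‖) t (a ^ 2 + b ^ 2))]
  refine integral_congr_ae (Eventually.of_forall fun x => ?_)
  have hx : ‖x‖ ^ 2 = x 0 ^ 2 + (x 1 ^ 2 + x 2 ^ 2) := by
    rw [EuclideanSpace.real_norm_sq_eq, Fin.sum_univ_three]; ring
  have hx' : ‖x‖ = √(x 0 ^ 2 + (x 1 ^ 2 + x 2 ^ 2)) := by
    rw [← hx, sqrt_sq (norm_nonneg _)]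
  have hin : inner ℝ x e = ‖z‖ * x 0 := by simp [he, EuclideanSpace.inner_single_right]
  have hmem : A x ∈ Metric.ball (0 : E3) 1 ↔ x 0 ^ 2 + (x 1 ^ 2 + x 2 ^ 2) < 1 := by
    rw [mem_ball_zero_iff, A.norm_map, ← hx, sq_lt_one_iff₀ (norm_nonneg _)]
  simp only [Set.indicator, zonal, hmem, hAz, A.norm_map, hin, ← hx']
  split_ifs
  · congr 3; ring
  · rfl

lemma conj_greens (k : ℝ) (x y : E3) : starRingEnd ℂ (greens k x y) = greens (-k) x y := by
  unfold greens
  rw [map_div₀, ← Complex.exp_conj, Complex.conj_ofReal]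
  simp [Complex.conj_ofReal]

lemma greens_comm (k : ℝ) (x y : E3) : greens k x y = greens k y x := by
  unfold greens
  rw [norm_sub_rev]

lemma greens_sub_greens_neg (k : ℝ) {x y : E3} (hxy : x ≠ y) :
    greens k x y - greens (-k) x y = Complex.I * k / (2 * π) * (sinc (k * ‖x - y‖) : ℂ) := by
  have hr : ‖x - y‖ ≠ 0 := by simpa [sub_eq_zero] using hxy
  by_cases hk : k = 0
  · subst hk; simp
  have hrC : (‖x - y‖ : ℂ) ≠ 0 := by exact_mod_cast hr
  have hkC : (k : ℂ) ≠ 0 := by exact_mod_cast hk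
  have hpi : (π : ℂ) ≠ 0 := by exact_mod_cast pi_ne_zero
  rw [sinc_of_ne_zero (mul_ne_zero hk hr)]
  unfold greens
  push_cast
  rw [Complex.sin]
  field_simp
  rw [show Complex.I ^ 2 = -1 from Complex.I_sq]
  ring_nf

lemma IsSource.conj {q : E3 → ℂ} {M R : ℝ} (h : IsSource q M R) :
    IsSource (fun y => starRingEnd ℂ (q y)) M R where
  meas := Complex.continuous_conj.measurable.comp h.meas
  bound y := by simpa using h.bound y
  supp y hy := by simp [h.supp y hy]

/-- The plane wave travelling in the direction `v / ‖v‖` with wave number `k`. -/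
def directedWave (k : ℝ) (v x : E3) : ℂ :=
  Complex.exp (Complex.I * ((k * (inner ℝ v x / ‖v‖) : ℝ) : ℂ))

lemma measurable_directedWave (k : ℝ) :
    Measurable fun z : E3 × E3 => directedWave k z.1 z.2 := by
  unfold directedWave
  refine Complex.measurable_exp.comp (measurable_const.mul (Complex.measurable_ofReal.comp ?_))
  exact measurable_const.mul ((by fun_prop : Measurable fun z : E3 × E3 => inner ℝ z.1 z.2).div
    measurable_fst.norm)

lemma norm_directedWave (k : ℝ) (v x : E3) : ‖directedWave k v x‖ = 1 := by
  rw [directedWave, mul_comm, Complex.norm_exp_ofReal_mul_I]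

lemma directedWave_sub (k : ℝ) (v x y : E3) :
    directedWave k v (x - y) = directedWave k v x * directedWave (-k) v y := by
  unfold directedWave
  rw [← Complex.exp_add, inner_sub_right]
  congr 1
  push_cast
  ring

lemma conj_directedWave (k : ℝ) (v x : E3) :
    starRingEnd ℂ (directedWave k v x) = directedWave (-k) v x := by
  unfold directedWave
  rw [← Complex.exp_conj]
  simp [Complex.conj_ofReal]

lemma sinc_eq_integral_directedWave (k : ℝ) (z : E3) :
    (sinc (k * ‖z‖) : ℂ) = 3 / (4 * π) * ∫ v in Metric.ball (0 : E3) 1, directedWave k v z := by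
  have hpi : (π : ℂ) ≠ 0 := by exact_mod_cast pi_ne_zero
  have := integral_ball_exp_direction k z
  unfold directedWave
  rw [this]
  field_simp

/-- The far-field amplitude of `q` in the direction `v / ‖v‖`. -/
def farField (k : ℝ) (q : E3 → ℂ) (v : E3) : ℂ := ∫ y, q y * directedWave (-k) v y

lemma IsSource.integral_sinc_mul {q : E3 → ℂ} {M R : ℝ} (h : IsSource q M R) (k : ℝ) (x : E3) :
    ∫ y, (sinc (k * ‖x - y‖) : ℂ) * q y
      = 3 / (4 * π) * ∫ v in Metric.ball (0 : E3) 1, directedWave k v x * farField k q v := by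
  simp_rw [sinc_eq_integral_directedWave, mul_assoc]
  rw [integral_const_mul]
  congr 1
  simp_rw [farField, ← integral_const_mul, ← integral_mul_const]
  rw [integral_integral_swap]
  · refine integral_congr_ae (Eventually.of_forall fun v => ?_)
    refine integral_congr_ae (Eventually.of_forall fun y => ?_)
    simp only [directedWave_sub]
    ring
  · have hfin : IsFiniteMeasure (volume.restrict (Metric.ball (0 : E3) 1)) :=
      ⟨by simp⟩
    refine Integrable.mono' (g := fun z : E3 × E3 => ‖q z.1‖ * (1 : ℝ))
      (h.integrable.norm.mul_prod (integrable_const _)) ?_ (Eventually.of_forall fun z => ?_)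
    · refine Measurable.aestronglyMeasurable ?_
      exact ((measurable_directedWave k).comp
        (measurable_snd.prodMk (measurable_const.sub measurable_fst))).mul (h.meas.comp measurable_fst)
    · simp [Function.uncurry, norm_directedWave]

lemma norm_farField_le (q : E3 → ℂ) (k : ℝ) (v : E3) :
    ‖farField k q v‖ ≤ ∫ y, ‖q y‖ := by
  refine (norm_integral_le_integral_norm _).trans (le_of_eq ?_)
  simp [norm_directedWave]

lemma IsSource.measurable_farField {q : E3 → ℂ} {M R : ℝ} (h : IsSource q M R) (k : ℝ) :
    StronglyMeasurable (farField k q) := by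
  refine StronglyMeasurable.integral_prod_right (f := fun v y => q y * directedWave (-k) v y) ?_
  exact ((h.meas.comp measurable_snd).mul (measurable_directedWave (-k))).stronglyMeasurable

lemma IsSource.integral_conj_sinc {q : E3 → ℂ} {M R : ℝ} (h : IsSource q M R) (k : ℝ) :
    ∫ x, starRingEnd ℂ (q x) * ∫ y, (sinc (k * ‖x - y‖) : ℂ) * q y
      = ((3 / (4 * π) * ∫ v in Metric.ball (0 : E3) 1, ‖farField k q v‖ ^ 2 : ℝ) : ℂ) := by
  have hfin : IsFiniteMeasure (volume.restrict (Metric.ball (0 : E3) 1)) :=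
    ⟨by simp⟩
  simp_rw [h.integral_sinc_mul]
  simp_rw [mul_left_comm _ (3 / (4 * (π : ℂ)))]
  rw [integral_const_mul]
  push_cast
  congr 1
  simp_rw [← integral_const_mul]
  rw [integral_integral_swap]
  · rw [← integral_complex_ofReal]
    refine integral_congr_ae (Eventually.of_forall fun v => ?_)
    have h1 : ∫ x, starRingEnd ℂ (q x) * directedWave k v x = starRingEnd ℂ (farField k q v) := by
      rw [farField, ← integral_conj]
      simp [conj_directedWave]
    simp only [← mul_assoc]
    rw [integral_mul_const, h1, mul_comm, Complex.mul_conj, Complex.normSq_eq_norm_sq]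
  · refine Integrable.mono' (g := fun z : E3 × E3 => ‖q z.1‖ * (∫ y, ‖q y‖))
      (h.integrable.norm.mul_prod (integrable_const _)) ?_ (Eventually.of_forall fun z => ?_)
    · refine Measurable.aestronglyMeasurable ?_
      exact (h.conj.meas.comp measurable_fst).mul (((measurable_directedWave k).comp
        measurable_swap).mul ((h.measurable_farField k).measurable.comp measurable_snd))
    · simp only [Function.uncurry, norm_mul, norm_directedWave, one_mul, RCLike.norm_conj]
      exact mul_le_mul_of_nonneg_left (norm_farField_le q k _) (norm_nonneg _)

lemma IsSource.potential_sub_potential_neg {q : E3 → ℂ} {M R : ℝ} (h : IsSource q M R) (k : ℝ)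
    (x : E3) : potential k q x - potential (-k) q x
      = Complex.I * k / (2 * π) * ∫ y, (sinc (k * ‖x - y‖) : ℂ) * q y := by
  unfold potential
  rw [← integral_sub (h.integrable_greens k x) (h.integrable_greens (-k) x), ← integral_const_mul]
  refine integral_congr_ae ?_
  filter_upwards [(measure_singleton x : volume {x} = 0) |> compl_mem_ae_iff.2] with y hy
  rw [← sub_mul, greens_sub_greens_neg k (Ne.symm hy), mul_assoc]

lemma IsSource.conj_integral_conj_potential {q : E3 → ℂ} {M R : ℝ} (h : IsSource q M R) (k : ℝ) :
    starRingEnd ℂ (∫ x, starRingEnd ℂ (q x) * potential k q x)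
      = ∫ x, starRingEnd ℂ (q x) * potential (-k) q x := by
  have h1 := h.conj.integrable_prod (-k) h.integrable
  rw [← integral_conj]
  simp only [map_mul, Complex.conj_conj, potential, ← integral_conj, conj_greens]
  simp_rw [← integral_const_mul]
  rw [integral_integral_swap h1]
  refine integral_congr_ae (Eventually.of_forall fun y => ?_)
  refine integral_congr_ae (Eventually.of_forall fun x => ?_)
  simp only [greens_comm (-k) x y]
  ring

/-- If the energy of `q` does not radiate outwards, the outgoing and incoming potentials agree. -/
lemma IsSource.potential_neg_eq {q : E3 → ℂ} {M R : ℝ} (h : IsSource q M R) {k : ℝ} (hk : 0 < k)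
    (him : (∫ x, starRingEnd ℂ (q x) * potential k q x).im ≤ 0) (x : E3) :
    potential k q x = potential (-k) q x := by
  have hfin : IsFiniteMeasure (volume.restrict (Metric.ball (0 : E3) 1)) :=
    ⟨by simp⟩
  set J := ∫ v in Metric.ball (0 : E3) 1, ‖farField k q v‖ ^ 2 with hJ
  have hmul : ∀ k', Integrable fun x => starRingEnd ℂ (q x) * potential k' q x := by
    intro k'
    obtain ⟨C, hC⟩ := h.exists_norm_potential_le k'
    simpa [mul_comm] using h.conj.integrable_mul (h.measurable_potential k') fun y _ => hC y
  have hI : (∫ x, starRingEnd ℂ (q x) * potential k q x)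
      - starRingEnd ℂ (∫ x, starRingEnd ℂ (q x) * potential k q x)
      = Complex.I * ((k / (2 * π) * (3 / (4 * π) * J) : ℝ) : ℂ) := by
    rw [h.conj_integral_conj_potential, ← integral_sub (hmul _) (hmul _)]
    simp_rw [← mul_sub, h.potential_sub_potential_neg,
      mul_left_comm _ (Complex.I * k / (2 * (π : ℂ)))]
    rw [integral_const_mul, h.integral_conj_sinc]
    push_cast
    ring
  have hJ0 : J ≤ 0 := by
    have h2 := congrArg Complex.im hI
    simp only [Complex.sub_im, Complex.conj_im, Complex.I_mul_im, Complex.ofReal_re] at h2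
    by_contra! hpos
    have : 0 < k / (2 * π) * (3 / (4 * π) * J) := by positivity
    linarith
  have hbd : Integrable (fun v => ‖farField k q v‖ ^ 2)
      (volume.restrict (Metric.ball (0 : E3) 1)) := by
    refine Integrable.of_bound
      ((h.measurable_farField k).norm.pow 2).aestronglyMeasurable ((∫ y, ‖q y‖) ^ 2)
      (Eventually.of_forall fun v => ?_)
    rw [norm_pow, norm_norm]
    exact pow_le_pow_left₀ (norm_nonneg _) (norm_farField_le q k v) 2
  have hJe : J = 0 := le_antisymm hJ0 (integral_nonneg fun v => sq_nonneg _)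
  have hae := (integral_eq_zero_iff_of_nonneg (fun v => sq_nonneg _) hbd).1 hJe
  rw [← sub_eq_zero, h.potential_sub_potential_neg, h.integral_sinc_mul]
  rw [integral_eq_zero_of_ae, mul_zero, mul_zero]
  filter_upwards [hae] with v hv
  have : farField k q v = 0 := by simpa using hv
  simp [this]

/-- Holomorphy of an integral depending on a complex parameter, under local domination. -/
lemma differentiableOn_integral_ball {α : Type*} [MeasurableSpace α] {μ : Measure α}
    {F : ℂ → α → ℂ} {r : ℝ} {bound : α → ℝ} (hm : ∀ s, AEStronglyMeasurable (F s) μ)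
    (hb : ∀ s ∈ Metric.ball (0 : ℂ) r, ∀ y, ‖F s y‖ ≤ bound y) (hbi : Integrable bound μ)
    (hd : ∀ y, DifferentiableOn ℂ (fun s => F s y) (Metric.ball 0 r)) :
    DifferentiableOn ℂ (fun s => ∫ y, F s y ∂μ) (Metric.ball 0 r) := by
  intro s₀ hs₀
  obtain ⟨δ, hδ, hsub⟩ := Metric.isOpen_iff.1 Metric.isOpen_ball s₀ hs₀
  have hda : ∀ y, ∀ s ∈ Metric.ball s₀ δ, HasDerivAt (fun s => F s y) (deriv (fun s => F s y) s) s :=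
    fun y s hs => ((hd y).differentiableAt (Metric.isOpen_ball.mem_nhds (hsub hs))).hasDerivAt
  have hhalf : Metric.ball s₀ (δ / 2) ⊆ Metric.ball s₀ δ := Metric.ball_subset_ball (by linarith)
  have hmd : AEStronglyMeasurable (fun y => deriv (fun s => F s y) s₀) μ := by
    have hlim : Tendsto (fun n : ℕ => ((1 / ((n : ℝ) + 1) : ℝ) : ℂ)) atTop (𝓝[≠] 0) := by
      refine tendsto_nhdsWithin_iff.2 ⟨?_, Eventually.of_forall fun n => ?_⟩
      · exact_mod_cast (Complex.continuous_ofReal.tendsto 0).comp tendsto_one_div_add_atTop_nhds_zero_nat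
      · have : (1 / ((n : ℝ) + 1)) ≠ 0 := by positivity
        exact Complex.ofReal_ne_zero.2 this
    refine aestronglyMeasurable_of_tendsto_ae atTop (f := fun (n : ℕ) y =>
      (((1 / ((n : ℝ) + 1) : ℝ) : ℂ))⁻¹ • (F (s₀ + ((1 / ((n : ℝ) + 1) : ℝ) : ℂ)) y - F s₀ y))
      (fun n => ((hm _).sub (hm _)).const_mul _) (Eventually.of_forall fun y => ?_)
    exact (hasDerivAt_iff_tendsto_slope_zero.1 (hda y s₀ (Metric.mem_ball_self hδ))).comp hlim
  have hres := hasDerivAt_integral_of_dominated_loc_of_deriv_le (μ := μ) (F := F)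
    (F' := fun s y => deriv (fun s => F s y) s) (bound := fun y => bound y / (δ / 4))
    (x₀ := s₀) (Metric.ball_mem_nhds s₀ (half_pos hδ)) (Eventually.of_forall hm)
    (hbi.mono' (hm s₀) (Eventually.of_forall fun y => hb s₀ hs₀ y)) hmd
    (Eventually.of_forall fun y s hs => ?_) (hbi.div_const _)
    (Eventually.of_forall fun y s hs => hda y s (hhalf hs))
  · exact hres.2.differentiableAt.differentiableWithinAt
  · have hcb : Metric.closedBall s (δ / 4) ⊆ Metric.ball s₀ δ := by
      intro z hz
      rw [Metric.mem_ball] at hs ⊢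
      rw [Metric.mem_closedBall] at hz
      linarith [dist_triangle z s s₀]
    refine Complex.norm_deriv_le_of_forall_mem_sphere_norm_le (by positivity) ?_ fun z hz =>
      hb z (hsub (hcb (Metric.sphere_subset_closedBall hz))) y
    refine (((hd y).mono hsub).mono hcb).diffContOnCl_ball le_rfl

/-- The holomorphic branch of the square root. -/
def branchSqrt (z : ℂ) : ℂ := Complex.exp (Complex.log z / 2)

lemma branchSqrt_sq {z : ℂ} (hz : z ≠ 0) : branchSqrt z ^ 2 = z := by
  rw [branchSqrt, ← Complex.exp_nat_mul]
  rw [show ((2 : ℕ) : ℂ) * (Complex.log z / 2) = Complex.log z by push_cast; ring,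
    Complex.exp_log hz]

lemma branchSqrt_ofReal {x : ℝ} (hx : 0 < x) : branchSqrt x = (√x : ℝ) := by
  rw [branchSqrt, ← Complex.ofReal_log hx.le]
  rw [show ((Real.log x : ℝ) : ℂ) / 2 = ((Real.log x / 2 : ℝ) : ℂ) by push_cast; ring,
    ← Complex.ofReal_exp, Real.exp_half, Real.exp_log hx]

lemma branchSqrt_re_nonneg (z : ℂ) : 0 ≤ (branchSqrt z).re := by
  rw [branchSqrt, Complex.exp_re]
  refine mul_nonneg (Real.exp_pos _).le (Real.cos_nonneg_of_mem_Icc ?_)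
  have h1 := Complex.neg_pi_lt_arg z
  have h2 := Complex.arg_le_pi z
  have : (Complex.log z / 2).im = Complex.arg z / 2 := by
    rw [show (2 : ℂ) = ((2 : ℝ) : ℂ) by norm_num, Complex.div_ofReal_im, Complex.log_im]
  rw [this]
  constructor <;> linarith

lemma branchSqrt_ne_zero (z : ℂ) : branchSqrt z ≠ 0 := Complex.exp_ne_zero _

lemma measurable_branchSqrt : Measurable branchSqrt :=
  Complex.measurable_exp.comp (Complex.measurable_log.div_const 2)

/-- The squared distance from `θ` to `s y`, extended to complex `s`, for unit vectors `θ`. -/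
def inversionDistSq (θ y : E3) (s : ℂ) : ℂ :=
  1 - 2 * s * (inner ℝ θ y : ℝ) + s ^ 2 * ((‖y‖ ^ 2 : ℝ) : ℂ)

/-- The kernel `G` near infinity, in the inverted radial variable `s`. -/
def inversionKernel (k : ℝ) (θ y : E3) (s : ℂ) : ℂ :=
  Complex.exp (Complex.I * k * ((-2 * (inner ℝ θ y : ℝ) + s * ((‖y‖ ^ 2 : ℝ) : ℂ)) /
    (branchSqrt (inversionDistSq θ y s) + 1))) / branchSqrt (inversionDistSq θ y s)

section

variable {θ y : E3} {R : ℝ} {s : ℂ}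

lemma norm_inversionDistSq_sub_one_le (hθ : ‖θ‖ = 1) (hR : 0 < R) (hy : ‖y‖ < R)
    (hs : s ∈ Metric.ball (0 : ℂ) (1 / (8 * R))) : ‖inversionDistSq θ y s - 1‖ ≤ 1 / 2 := by
  have ha : |inner ℝ θ y| ≤ R := by
    have := abs_real_inner_le_norm θ y
    rw [hθ, one_mul] at this
    linarith
  have hs' : ‖s‖ * R ≤ 1 / 8 := by
    have h1 : ‖s‖ < 1 / (8 * R) := by simpa using hs
    rw [lt_div_iff₀ (by positivity)] at h1
    linarith
  have e : inversionDistSq θ y s - 1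
      = -(2 * s * (inner ℝ θ y : ℝ)) + s ^ 2 * ((‖y‖ ^ 2 : ℝ) : ℂ) := by
    unfold inversionDistSq; ring
  rw [e]
  refine (norm_add_le _ _).trans ?_
  rw [norm_neg, norm_mul, norm_mul, norm_mul, norm_pow, Complex.norm_real, Complex.norm_real,
    Real.norm_eq_abs, Real.norm_of_nonneg (by positivity), Complex.norm_ofNat]
  have h2 : ‖s‖ * |inner ℝ θ y| ≤ ‖s‖ * R := mul_le_mul_of_nonneg_left ha (norm_nonneg _)
  have h3 : ‖s‖ * ‖y‖ ≤ ‖s‖ * R := mul_le_mul_of_nonneg_left hy.le (norm_nonneg _)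
  have h4 : (‖s‖ * ‖y‖) ^ 2 ≤ (1 / 8) ^ 2 :=
    pow_le_pow_left₀ (by positivity) (h3.trans hs') 2
  nlinarith

lemma half_le_re_inversionDistSq (hθ : ‖θ‖ = 1) (hR : 0 < R) (hy : ‖y‖ < R)
    (hs : s ∈ Metric.ball (0 : ℂ) (1 / (8 * R))) : 1 / 2 ≤ (inversionDistSq θ y s).re := by
  have h1 := (Complex.abs_re_le_norm _).trans (norm_inversionDistSq_sub_one_le hθ hR hy hs)
  have := (abs_le.1 h1).1
  simp only [Complex.sub_re, Complex.one_re] at this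
  linarith

lemma branchSqrt_add_one_ne_zero (z : ℂ) : branchSqrt z + 1 ≠ 0 := by
  intro h
  have h1 := congrArg Complex.re h
  simp only [Complex.add_re, Complex.one_re, Complex.zero_re] at h1
  linarith [branchSqrt_re_nonneg z]

lemma differentiableAt_inversionKernel (k : ℝ) (hθ : ‖θ‖ = 1) (hR : 0 < R) (hy : ‖y‖ < R)
    (hs : s ∈ Metric.ball (0 : ℂ) (1 / (8 * R))) :
    DifferentiableAt ℂ (inversionKernel k θ y) s := by
  have hre := half_le_re_inversionDistSq hθ hR hy hs
  have hD : DifferentiableAt ℂ (inversionDistSq θ y) s := by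
    unfold inversionDistSq; fun_prop
  have hsq : DifferentiableAt ℂ (fun s => branchSqrt (inversionDistSq θ y s)) s :=
    ((hD.clog (Or.inl (by linarith))).div_const 2).cexp
  unfold inversionKernel
  refine DifferentiableAt.div (DifferentiableAt.cexp (DifferentiableAt.const_mul
    (DifferentiableAt.div (by fun_prop) (hsq.add_const 1) (branchSqrt_add_one_ne_zero _)) _)) hsq
    (branchSqrt_ne_zero _)

lemma norm_inversionKernel_le (k : ℝ) (hθ : ‖θ‖ = 1) (hR : 0 < R) (hy : ‖y‖ < R)
    (hs : s ∈ Metric.ball (0 : ℂ) (1 / (8 * R))) :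
    ‖inversionKernel k θ y s‖ ≤ Real.exp (|k| * (3 * R)) * 2 := by
  have hre := half_le_re_inversionDistSq hθ hR hy hs
  set D := inversionDistSq θ y s with hD
  have hD0 : D ≠ 0 := by
    intro h; rw [h, Complex.zero_re] at hre; linarith
  have hm2 : 1 / 2 ≤ ‖branchSqrt D‖ ^ 2 := by
    rw [← norm_pow, branchSqrt_sq hD0]
    exact hre.trans (Complex.re_le_norm D)
  have hm : 1 / 2 ≤ ‖branchSqrt D‖ := by
    by_contra! h
    nlinarith [norm_nonneg (branchSqrt D)]
  have hm1 : 1 ≤ ‖branchSqrt D + 1‖ := by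
    refine le_trans ?_ (Complex.re_le_norm _)
    simp only [Complex.add_re, Complex.one_re]
    linarith [branchSqrt_re_nonneg D]
  have ha : |inner ℝ θ y| ≤ R := by
    have := abs_real_inner_le_norm θ y
    rw [hθ, one_mul] at this
    linarith
  have hs' : ‖s‖ * R ≤ 1 / 8 := by
    have h1 : ‖s‖ < 1 / (8 * R) := by simpa using hs
    rw [lt_div_iff₀ (by positivity)] at h1
    linarith
  have hnum : ‖-2 * ((inner ℝ θ y : ℝ) : ℂ) + s * ((‖y‖ ^ 2 : ℝ) : ℂ)‖ ≤ 3 * R := by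
    refine (norm_add_le _ _).trans ?_
    rw [norm_mul, norm_mul, Complex.norm_real, Complex.norm_real, Real.norm_eq_abs,
      Real.norm_of_nonneg (by positivity), norm_neg, Complex.norm_ofNat]
    have h3 : ‖y‖ ^ 2 ≤ R ^ 2 := pow_le_pow_left₀ (norm_nonneg _) hy.le 2
    have h4 : ‖s‖ * ‖y‖ ^ 2 ≤ ‖s‖ * R ^ 2 := mul_le_mul_of_nonneg_left h3 (norm_nonneg _)
    nlinarith
  unfold inversionKernel
  rw [← hD, norm_div, div_eq_mul_inv]
  refine mul_le_mul ?_ ?_ (by positivity) (Real.exp_pos _).le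
  · rw [Complex.norm_exp, Real.exp_le_exp]
    refine (Complex.re_le_norm _).trans ?_
    rw [norm_mul, norm_mul, Complex.norm_I, one_mul, Complex.norm_real, Real.norm_eq_abs, norm_div]
    refine mul_le_mul_of_nonneg_left ?_ (abs_nonneg _)
    exact (div_le_self (norm_nonneg _) hm1).trans hnum
  · exact (inv_le_comm₀ (by linarith) two_pos).2 (by linarith)

lemma measurable_inversionKernel (k : ℝ) (θ : E3) (s : ℂ) :
    Measurable fun y => inversionKernel k θ y s := by
  have hD : Measurable fun y => branchSqrt (inversionDistSq θ y s) := by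
    refine measurable_branchSqrt.comp ?_
    unfold inversionDistSq
    fun_prop
  unfold inversionKernel
  refine Measurable.div (Complex.measurable_exp.comp (measurable_const.mul
    (Measurable.div ?_ (hD.add_const 1)))) hD
  fun_prop

lemma greens_eq_inversionKernel (k : ℝ) (hθ : ‖θ‖ = 1) (hR : 0 < R) (hy : ‖y‖ < R) {t : ℝ}
    (ht : 0 < t) (ht' : t < 1 / (8 * R)) :
    greens k (t⁻¹ • θ) y
      = t / (4 * π) * Complex.exp (Complex.I * ((k / t : ℝ) : ℂ)) * inversionKernel k θ y t := by
  set d : ℝ := 1 - 2 * t * inner ℝ θ y + t ^ 2 * ‖y‖ ^ 2 with hd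
  have hdC : inversionDistSq θ y t = (d : ℂ) := by
    rw [hd, inversionDistSq]; push_cast; ring
  have hs : (t : ℂ) ∈ Metric.ball (0 : ℂ) (1 / (8 * R)) := by
    simpa [abs_of_pos ht] using ht'
  have hd0 : 0 < d := by
    have := half_le_re_inversionDistSq hθ hR hy hs
    rw [hdC, Complex.ofReal_re] at this
    linarith
  have hnorm : ‖t⁻¹ • θ - y‖ = √d / t := by
    have h1 : ‖θ - t • y‖ ^ 2 = d := by
      rw [norm_sub_sq_real, norm_smul, hθ, inner_smul_right, hd, Real.norm_of_nonneg ht.le]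
      ring
    have h2 : t⁻¹ • θ - y = t⁻¹ • (θ - t • y) := by
      rw [smul_sub, smul_smul, inv_mul_cancel₀ ht.ne', one_smul]
    rw [h2, norm_smul, ← h1, sqrt_sq (norm_nonneg _), Real.norm_of_nonneg (by positivity)]
    field_simp
  have hsd : 0 < √d := sqrt_pos.2 hd0
  have hphase : (-2 * inner ℝ θ y + t * ‖y‖ ^ 2) / (√d + 1) = √d / t - 1 / t := by
    have := sq_sqrt hd0.le
    field_simp
    nlinarith
  unfold greens inversionKernel
  rw [hdC, branchSqrt_ofReal hd0, hnorm]
  have hphase' : (-2 * ((inner ℝ θ y : ℝ) : ℂ) + t * ((‖y‖ ^ 2 : ℝ) : ℂ)) / (((√d : ℝ) : ℂ) + 1)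
      = ((√d / t - 1 / t : ℝ) : ℂ) := by
    rw [← hphase]; push_cast; ring
  rw [hphase']
  have htC : (t : ℂ) ≠ 0 := by exact_mod_cast ht.ne'
  have hsC : ((√d : ℝ) : ℂ) ≠ 0 := by exact_mod_cast hsd.ne'
  have hpi : (π : ℂ) ≠ 0 := by exact_mod_cast pi_ne_zero
  have he : Complex.I * ((k / t : ℝ) : ℂ) + Complex.I * k * ((√d / t - 1 / t : ℝ) : ℂ)
      = Complex.I * k * ((√d / t : ℝ) : ℂ) := by
    push_cast; ring
  rw [← he, Complex.exp_add]
  push_cast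
  field_simp

end

/-- The amplitude of the potential of `q` along the ray `θ`, in the inverted variable `s`. -/
def rayAmplitude (k : ℝ) (q : E3 → ℂ) (θ : E3) (s : ℂ) : ℂ :=
  ∫ y, inversionKernel k θ y s * q y

lemma IsSource.differentiableOn_rayAmplitude {q : E3 → ℂ} {M R : ℝ} (h : IsSource q M R)
    (hR : 0 < R) (k : ℝ) {θ : E3} (hθ : ‖θ‖ = 1) :
    DifferentiableOn ℂ (rayAmplitude k q θ) (Metric.ball 0 (1 / (8 * R))) := by
  refine differentiableOn_integral_ball (bound := fun y => Real.exp (|k| * (3 * R)) * 2 * ‖q y‖)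
    (fun s => ((measurable_inversionKernel k θ s).mul h.meas).aestronglyMeasurable) ?_
    (h.integrable.norm.const_mul _) fun y => ?_
  · intro s hs y
    by_cases hy : ‖y‖ < R
    · rw [norm_mul]
      exact mul_le_mul_of_nonneg_right (norm_inversionKernel_le k hθ hR hy hs) (norm_nonneg _)
    · simp [h.supp y (not_lt.1 hy)]
  · by_cases hy : ‖y‖ < R
    · exact fun s hs =>
        ((differentiableAt_inversionKernel k hθ hR hy hs).mul_const _).differentiableWithinAt
    · simp only [h.supp y (not_lt.1 hy), mul_zero]
      exact differentiableOn_const _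

lemma IsSource.potential_ray {q : E3 → ℂ} {M R : ℝ} (h : IsSource q M R)
    (hR : 0 < R) (k : ℝ) {θ : E3} (hθ : ‖θ‖ = 1) {t : ℝ} (ht : 0 < t) (ht' : t < 1 / (8 * R)) :
    potential k q (t⁻¹ • θ) = t / (4 * π) * Complex.exp (Complex.I * ((k / t : ℝ) : ℂ)) *
      rayAmplitude k q θ t := by
  unfold potential rayAmplitude
  rw [← integral_const_mul]
  refine integral_congr_ae (Eventually.of_forall fun y => ?_)
  by_cases hy : ‖y‖ < R
  · simp only [greens_eq_inversionKernel k hθ hR hy ht ht', mul_assoc]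
  · simp [h.supp y (not_lt.1 hy)]

/-- A holomorphic function vanishing along a real sequence tending to the centre vanishes. -/
lemma eqOn_zero_of_tendsto {f : ℂ → ℂ} {r : ℝ} (hr : 0 < r)
    (hf : DifferentiableOn ℂ f (Metric.ball 0 r)) {s : ℕ → ℝ} (hs : Tendsto s atTop (𝓝 0))
    (hpos : ∀ n, 0 < s n) (h0 : ∀ n, s n < r → f (s n) = 0) :
    ∀ z ∈ Metric.ball (0 : ℂ) r, f z = 0 := by
  have hlim : Tendsto (fun n => (s n : ℂ)) atTop (𝓝[≠] 0) := by
    refine tendsto_nhdsWithin_iff.2 ⟨?_, Eventually.of_forall fun n => ?_⟩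
    · exact_mod_cast (Complex.continuous_ofReal.tendsto 0).comp hs
    · exact Complex.ofReal_ne_zero.2 (hpos n).ne'
  have hev : ∀ᶠ n in atTop, f (s n) = 0 :=
    (hs.eventually (gt_mem_nhds hr)).mono fun n hn => h0 n hn
  exact (hf.analyticOnNhd Metric.isOpen_ball).eqOn_zero_of_preconnected_of_frequently_eq_zero
    (convex_ball 0 r).isPreconnected (Metric.mem_ball_self hr) (hlim.frequently hev.frequently)

/-- If the outgoing and the incoming potentials of a source agree, they vanish near infinity. -/
lemma IsSource.potential_eq_zero_of_neg_eq {q : E3 → ℂ} {M R : ℝ} (h : IsSource q M R)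
    (hR : 0 < R) {k : ℝ} (hk : 0 < k) (heq : ∀ x, potential k q x = potential (-k) q x)
    {x : E3} (hx : 8 * R < ‖x‖) : potential k q x = 0 := by
  have hx0 : 0 < ‖x‖ := by linarith
  set θ : E3 := ‖x‖⁻¹ • x with hθd
  have hθ : ‖θ‖ = 1 := by rw [hθd, norm_smul, norm_inv, norm_norm, inv_mul_cancel₀ hx0.ne']
  have hr : 0 < 1 / (8 * R) := by positivity
  have hA := h.differentiableOn_rayAmplitude hR k hθ
  have hB := h.differentiableOn_rayAmplitude hR (-k) hθ
  have hamp : ∀ t : ℝ, 0 < t → t < 1 / (8 * R) →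
      Complex.exp (Complex.I * ((k / t : ℝ) : ℂ)) ^ 2 * rayAmplitude k q θ t
        = rayAmplitude (-k) q θ t := by
    intro t ht ht'
    have h1 := heq (t⁻¹ • θ)
    rw [h.potential_ray hR k hθ ht ht', h.potential_ray hR (-k) hθ ht ht', mul_assoc, mul_assoc]
      at h1
    have hne : (t : ℂ) / (4 * π) ≠ 0 := by
      have : t / (4 * π) ≠ 0 := by positivity
      exact_mod_cast this
    have h2 := mul_left_cancel₀ hne h1
    have h3 : Complex.exp (Complex.I * ((-k / t : ℝ) : ℂ))
        = (Complex.exp (Complex.I * ((k / t : ℝ) : ℂ)))⁻¹ := by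
      rw [← Complex.exp_neg]; congr 1; push_cast; ring
    rw [h3] at h2
    rw [sq, mul_assoc, h2, mul_inv_cancel_left₀ (Complex.exp_ne_zero _)]
  have htend : ∀ c : ℝ, 0 ≤ c →
      Tendsto (fun n : ℕ => k / ((n + 1 + c) * π)) atTop (𝓝 0) := by
    intro c hc
    refine Tendsto.div_atTop tendsto_const_nhds ?_
    refine Tendsto.atTop_mul_const pi_pos ?_
    exact tendsto_atTop_add_const_right _ _
      (tendsto_atTop_add_const_right _ _ tendsto_natCast_atTop_atTop)
  have hphase : ∀ (c : ℝ), 0 ≤ c → ∀ n : ℕ,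
      Complex.exp (Complex.I * ((k / (k / ((n + 1 + c) * π)) : ℝ) : ℂ)) ^ 2
        = Complex.exp (2 * c * π * Complex.I) := by
    intro c hc n
    have e : k / (k / ((n + 1 + c) * π)) = (n + 1 + c) * π := by
      field_simp
    rw [e, ← Complex.exp_nat_mul]
    refine Complex.exp_eq_exp_iff_exists_int.2 ⟨n + 1, ?_⟩
    push_cast
    ring
  have hAB : ∀ z ∈ Metric.ball (0 : ℂ) (1 / (8 * R)),
      rayAmplitude k q θ z - rayAmplitude (-k) q θ z = 0 := by
    refine eqOn_zero_of_tendsto hr (hA.sub hB) (htend 0 le_rfl) (fun n => by positivity) ?_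
    intro n hn
    have h1 := hamp _ (by positivity) hn
    rw [hphase 0 le_rfl n] at h1
    rw [← h1]
    simp
  have hAB' : ∀ z ∈ Metric.ball (0 : ℂ) (1 / (8 * R)),
      rayAmplitude k q θ z + rayAmplitude (-k) q θ z = 0 := by
    refine eqOn_zero_of_tendsto hr (hA.add hB) (htend (1 / 2) (by norm_num))
      (fun n => by positivity) ?_
    intro n hn
    have h1 := hamp _ (by positivity) hn
    rw [hphase (1 / 2) (by norm_num) n] at h1
    have h2 : Complex.exp (2 * ((1 / 2 : ℝ) : ℂ) * π * Complex.I) = -1 := by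
      rw [← Complex.exp_pi_mul_I]; congr 1; push_cast; ring
    rw [h2] at h1
    rw [← h1]
    ring
  have ht : 0 < ‖x‖⁻¹ := by positivity
  have ht' : ‖x‖⁻¹ < 1 / (8 * R) := by
    rw [inv_eq_one_div]; exact one_div_lt_one_div_of_lt (by positivity) hx
  have hmem : ((‖x‖⁻¹ : ℝ) : ℂ) ∈ Metric.ball (0 : ℂ) (1 / (8 * R)) := by
    rw [mem_ball_zero_iff, Complex.norm_real, Real.norm_of_nonneg ht.le]; exact ht'
  have hz : rayAmplitude k q θ ((‖x‖⁻¹ : ℝ) : ℂ) = 0 := by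
    have h1 := hAB _ hmem
    have h2 := hAB' _ hmem
    linear_combination (1 / 2 : ℂ) * h1 + (1 / 2 : ℂ) * h2
  have hxθ : x = (‖x‖⁻¹)⁻¹ • θ := by
    rw [hθd, inv_inv, smul_smul, mul_inv_cancel₀ hx0.ne', one_smul]
  rw [hxθ, h.potential_ray hR k hθ ht ht', hz, mul_zero]

section

attribute [local instance] instMeasureSpaceUnitAddCircle

/-- The representative in the cube `(-1/2, 1/2]³` of a point of the torus. -/
def cubeRep (t : UnitAddTorus (Fin 3)) : E3 :=
  WithLp.toLp 2 fun i => (AddCircle.equivIoc (1 : ℝ) (-1 / 2) (t i) : ℝ)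

lemma measurable_cubeRep : Measurable cubeRep := by
  refine (MeasurableEquiv.toLp 2 (Fin 3 → ℝ)).measurable.comp (measurable_pi_lambda _ fun i => ?_)
  exact measurable_subtype_coe.comp
    ((AddCircle.measurableEquivIoc (1 : ℝ) (-1 / 2)).measurable.comp (measurable_pi_apply i))

lemma coe_cubeRep (t : UnitAddTorus (Fin 3)) (i : Fin 3) :
    ((cubeRep t i : ℝ) : UnitAddCircle) = t i :=
  AddCircle.coe_equivIoc (p := (1 : ℝ)) (a := -1 / 2)

lemma integral_comp_cubeRep {F : Type*} [NormedAddCommGroup F] [NormedSpace ℝ F] {L : ℝ}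
    (hL : 0 < L) (g : E3 → F) (hg : ∀ x, L / 2 ≤ ‖x‖ → g x = 0) :
    ∫ t : UnitAddTorus (Fin 3), g (L • cubeRep t) = (L ^ 3)⁻¹ • ∫ x, g x := by
  rw [UnitAddTorus.integral_preimage _ (fun _ => (-1 / 2 : ℝ))]
  have h1 : ∀ x ∈ {x : Fin 3 → ℝ | ∀ i, x i ∈ Set.Ioc (-1 / 2 : ℝ) (-1 / 2 + 1)},
      g (L • cubeRep fun i => (x i : UnitAddCircle)) = g (L • WithLp.toLp 2 x) := by
    intro x hx
    congr 2
    ext i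
    simp only [cubeRep]
    exact AddCircle.equivIoc_coe_of_mem (p := (1 : ℝ)) (a := -1 / 2) (hx i)
  have hms : MeasurableSet {x : Fin 3 → ℝ | ∀ i, x i ∈ Set.Ioc (-1 / 2 : ℝ) (-1 / 2 + 1)} :=
    MeasurableSet.univ_pi' fun i => measurableSet_Ioc
  rw [setIntegral_congr_fun hms h1, setIntegral_eq_integral_of_forall_compl_eq_zero]
  · have h2 := (EuclideanSpace.volume_preserving_symm_measurableEquiv_toLp (Fin 3)).integral_comp'
      (g := fun x : Fin 3 → ℝ => g (L • WithLp.toLp 2 x))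
    rw [← h2]
    have h3 := Measure.integral_comp_smul_of_nonneg (volume : Measure E3) g L (hR := hL.le)
    rw [finrank_euclideanSpace_fin] at h3
    exact h3
  · intro x hx
    apply hg
    simp only [Set.mem_ofPred_eq, not_forall] at hx
    obtain ⟨i, hi⟩ := hx
    have hxi : 1 / 2 ≤ |x i| := by
      by_contra! h
      exact hi ⟨by linarith [(abs_lt.1 h).1], by linarith [(abs_lt.1 h).2]⟩
    have h4 := PiLp.norm_apply_le (WithLp.toLp 2 x : E3) i
    rw [norm_smul, Real.norm_of_nonneg hL.le]
    have h5 : |x i| ≤ ‖(WithLp.toLp 2 x : E3)‖ := h4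
    nlinarith

/-- The wave vectors of the lattice dual to `L ℤ³`. -/
def latticeVec (L : ℝ) (n : Fin 3 → ℤ) (i : Fin 3) : ℂ := 2 * π * n i / L

lemma mFourier_neg_eq_planeWave {L : ℝ} (hL : 0 < L) (n : Fin 3 → ℤ) (t : UnitAddTorus (Fin 3)) :
    UnitAddTorus.mFourier (-n) t = planeWave (latticeVec L n) (L • cubeRep t) := by
  have hLC : (L : ℂ) ≠ 0 := by exact_mod_cast hL.ne'
  have h1 : UnitAddTorus.mFourier (-n) t = ∏ i, fourier (-n i) (t i) := rfl
  rw [h1, planeWave, Finset.mul_sum, Complex.exp_sum]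
  refine Finset.prod_congr rfl fun i _ => ?_
  rw [← coe_cubeRep t i, fourier_coe_apply]
  congr 1
  simp only [latticeVec, PiLp.smul_apply, smul_eq_mul]
  push_cast
  field_simp

/-- Parseval's identity on the cube of side `L` for functions supported inside it. -/
lemma hasSum_sq_integral_planeWave {L : ℝ} (hL : 0 < L) {V : E3 → ℂ} {C : ℝ}
    (hV : IsSource V C (L / 2)) :
    HasSum (fun n : Fin 3 → ℤ => ‖((L ^ 3)⁻¹ : ℝ) • ∫ x, planeWave (latticeVec L n) x * V x‖ ^ 2)
      ((L ^ 3)⁻¹ * ∫ x, ‖V x‖ ^ 2) := by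
  have : IsProbabilityMeasure (volume : Measure UnitAddCircle) :=
    inferInstanceAs (IsProbabilityMeasure AddCircle.haarAddCircle)
  set f : UnitAddTorus (Fin 3) → ℂ := fun t => V (L • cubeRep t) with hf
  have hfm : Measurable f := hV.meas.comp (measurable_cubeRep.const_smul L)
  have hLp : MemLp f 2 volume := MemLp.of_bound hfm.aestronglyMeasurable C
    (Eventually.of_forall fun t => hV.bound _)
  have hP := UnitAddTorus.hasSum_sq_mFourierCoeff hLp.toLp
  have h1 : ∀ n, UnitAddTorus.mFourierCoeff hLp.toLp n
      = ((L ^ 3)⁻¹ : ℝ) • ∫ x, planeWave (latticeVec L n) x * V x := by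
    intro n
    rw [← integral_comp_cubeRep hL (fun x => planeWave (latticeVec L n) x * V x)
      (fun x hx => by simp [hV.supp x hx])]
    unfold UnitAddTorus.mFourierCoeff
    refine integral_congr_ae ?_
    filter_upwards [hLp.coeFn_toLp] with t ht
    rw [ht, mFourier_neg_eq_planeWave hL, smul_eq_mul]
  have h2 : ∫ t, ‖(hLp.toLp : UnitAddTorus (Fin 3) → ℂ) t‖ ^ 2 = (L ^ 3)⁻¹ * ∫ x, ‖V x‖ ^ 2 := by
    rw [← smul_eq_mul, ← integral_comp_cubeRep hL (fun x => ‖V x‖ ^ 2)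
      (fun x hx => by simp [hV.supp x hx])]
    refine integral_congr_ae ?_
    filter_upwards [hLp.coeFn_toLp] with t ht
    rw [ht]
  rw [h2] at hP
  simpa only [h1] using hP

end

lemma integral_sq_le_of_planeWave_le {L : ℝ} (hL : 0 < L) {V W : E3 → ℂ} {C D c : ℝ}
    (hV : IsSource V C (L / 2)) (hW : IsSource W D (L / 2))
    (hc : ∀ n, ‖∫ x, planeWave (latticeVec L n) x * V x‖
      ≤ c * ‖∫ x, planeWave (latticeVec L n) x * W x‖) :
    ∫ x, ‖V x‖ ^ 2 ≤ c ^ 2 * ∫ x, ‖W x‖ ^ 2 := by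
  have h := hasSum_le (fun n => ?_) (hasSum_sq_integral_planeWave hL hV)
    ((hasSum_sq_integral_planeWave hL hW).mul_left (c ^ 2))
  · rw [mul_left_comm] at h
    exact le_of_mul_le_mul_left h (by positivity)
  · rw [← mul_pow, norm_smul, norm_smul, mul_left_comm]
    exact pow_le_pow_left₀ (by positivity)
      (mul_le_mul_of_nonneg_left (hc n) (norm_nonneg _)) 2

lemma planeWave_add (c d : Fin 3 → ℂ) (x : E3) :
    planeWave (c + d) x = planeWave c x * planeWave d x := by
  unfold planeWave
  rw [← Complex.exp_add]
  congr 1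
  simp only [Pi.add_apply, add_mul, Finset.sum_add_distrib]
  ring

/-- The complex shift of the dual lattice, of imaginary part `-τ e₀`. -/
def shiftVec (L τ : ℝ) : Fin 3 → ℂ := Pi.single 0 ((π / L : ℝ) - τ * Complex.I)

lemma le_norm_symbol {L τ : ℝ} (hL : 0 < L) (hτ : 0 < τ) (k : ℝ) (n : Fin 3 → ℤ) :
    2 * τ * π / L ≤ ‖∑ i, (latticeVec L n + shiftVec L τ) i ^ 2 - (k : ℂ) ^ 2‖ := by
  refine le_trans ?_ (Complex.abs_im_le_norm _)
  have hodd : (1 : ℝ) ≤ |2 * (n 0 : ℝ) + 1| := by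
    have : (1 : ℤ) ≤ |2 * n 0 + 1| := Int.one_le_abs (by omega)
    exact_mod_cast this
  have e : ∑ i, (latticeVec L n + shiftVec L τ) i ^ 2 - (k : ℂ) ^ 2
      = (((2 * n 0 + 1) * π / L) ^ 2 - τ ^ 2 + (2 * π * n 1 / L) ^ 2 + (2 * π * n 2 / L) ^ 2
          - k ^ 2 : ℝ) + ((-(2 * τ * π / L * (2 * n 0 + 1)) : ℝ) : ℂ) * Complex.I := by
    rw [Fin.sum_univ_three]
    simp only [shiftVec, latticeVec, Pi.add_apply, Pi.single_eq_same, ne_eq, Fin.reduceEq,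
      not_false_eq_true, Pi.single_eq_of_ne, add_zero, one_ne_zero]
    push_cast
    ring_nf
    rw [Complex.I_sq]
    ring
  rw [e, Complex.add_im, Complex.ofReal_im, zero_add, Complex.im_ofReal_mul, Complex.I_im, mul_one,
    abs_neg, abs_mul, abs_of_pos (by positivity : 0 < 2 * τ * π / L)]
  exact le_mul_of_one_le_right (by positivity) hodd

lemma IsSource.mono {q : E3 → ℂ} {M R R' : ℝ} (h : IsSource q M R) (hR : R ≤ R') :
    IsSource q M R' :=
  ⟨h.meas, h.bound, fun y hy => h.supp y (hR.trans hy)⟩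

lemma IsSource.exists_planeWave_mul {q : E3 → ℂ} {M R : ℝ} (h : IsSource q M R)
    (c : Fin 3 → ℂ) : ∃ C, IsSource (fun x => planeWave c x * q x) C R := by
  obtain ⟨C, hC⟩ := exists_norm_planeWave_le c R
  refine ⟨max C 0 * M, (continuous_planeWave c).measurable.mul h.meas, fun y => ?_,
    fun y hy => by simp [h.supp y hy]⟩
  by_cases hy : ‖y‖ < R
  · rw [norm_mul]
    exact mul_le_mul ((hC y hy).trans (le_max_left _ _)) (h.bound y) (norm_nonneg _)
      (le_max_right _ _)
  · rw [h.supp y (not_lt.1 hy), mul_zero, norm_zero]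
    exact mul_nonneg (le_max_right _ _) h.nonneg

lemma IsSource.integrable_sq {q : E3 → ℂ} {M R : ℝ} (h : IsSource q M R) :
    Integrable fun x => ‖q x‖ ^ 2 := by
  refine (h.integrable.norm.const_mul M).mono' (h.meas.norm.pow_const 2).aestronglyMeasurable
    (Eventually.of_forall fun x => ?_)
  rw [norm_pow, norm_norm, sq]
  exact mul_le_mul_of_nonneg_right (h.bound x) (norm_nonneg _)

/-- Unique continuation from infinity: a compactly supported potential which dominates its own
source vanishes. -/
lemma IsSource.potential_ae_eq_zero {q : E3 → ℂ} {M R : ℝ} (h : IsSource q M R) (hR : 0 < R)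
    (k : ℝ) {ρ : ℝ} (hρ : ∀ x, ρ ≤ ‖x‖ → potential k q x = 0) {P : ℝ} (hP : 0 ≤ P)
    (hdom : ∀ x, ‖q x‖ ≤ P * ‖potential k q x‖) : ∀ᵐ x, potential k q x = 0 := by
  obtain ⟨B, hB⟩ := h.exists_norm_potential_le k
  have hw : IsSource (potential k q) B ρ := ⟨h.measurable_potential k, hB, hρ⟩
  set L : ℝ := 2 * max ρ R with hLd
  have hL : 0 < L := by have := le_max_right ρ R; linarith
  have hL2 : L / 2 = max ρ R := by rw [hLd]; ring
  set τ : ℝ := L * (P + 1) / π with hτd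
  have hτ : 0 < τ := by positivity
  obtain ⟨C, hV⟩ := (hw.mono ((le_max_left ρ R).trans_eq hL2.symm)).exists_planeWave_mul
    (shiftVec L τ)
  obtain ⟨D, hW⟩ := (h.mono ((le_max_right ρ R).trans_eq hL2.symm)).exists_planeWave_mul
    (shiftVec L τ)
  have hc : ∀ n, ‖∫ x, planeWave (latticeVec L n) x * (planeWave (shiftVec L τ) x *
        potential k q x)‖ ≤ 1 / (2 * (P + 1)) * ‖∫ x, planeWave (latticeVec L n) x *
          (planeWave (shiftVec L τ) x * q x)‖ := by
    intro n
    simp_rw [← mul_assoc, ← planeWave_add]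
    rw [← h.integral_potential_planeWave k hρ (latticeVec L n + shiftVec L τ), norm_mul,
      ← mul_assoc]
    refine le_mul_of_one_le_left (norm_nonneg _) ?_
    have h1 := le_norm_symbol hL hτ k n
    have h2 : 2 * τ * π / L = 2 * (P + 1) := by
      rw [hτd]; field_simp
    rw [h2] at h1
    rw [one_div, inv_mul_eq_div, one_le_div (by positivity)]
    exact h1
  have hle := integral_sq_le_of_planeWave_le hL hV hW hc
  have hWV : ∫ x, ‖planeWave (shiftVec L τ) x * q x‖ ^ 2
      ≤ P ^ 2 * ∫ x, ‖planeWave (shiftVec L τ) x * potential k q x‖ ^ 2 := by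
    rw [← integral_const_mul]
    refine integral_mono hW.integrable_sq (hV.integrable_sq.const_mul _) fun x => ?_
    simp only
    rw [← mul_pow, norm_mul, norm_mul, mul_left_comm]
    exact pow_le_pow_left₀ (by positivity)
      (mul_le_mul_of_nonneg_left (hdom x) (norm_nonneg _)) 2
  set J := ∫ x, ‖planeWave (shiftVec L τ) x * potential k q x‖ ^ 2 with hJ
  have hJ0 : 0 ≤ J := integral_nonneg fun x => sq_nonneg _
  have hsmall : (1 / (2 * (P + 1))) ^ 2 * P ^ 2 ≤ 1 / 4 := by
    rw [← mul_pow, show (1 : ℝ) / 4 = (1 / 2) ^ 2 by norm_num]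
    refine pow_le_pow_left₀ (by positivity) ?_ 2
    rw [div_mul_eq_mul_div, one_mul, div_le_div_iff₀ (by positivity) two_pos]
    linarith
  have hJe : J = 0 := by
    have h1 : J ≤ (1 / (2 * (P + 1))) ^ 2 * P ^ 2 * J := by
      rw [mul_assoc]
      exact hle.trans (mul_le_mul_of_nonneg_left hWV (sq_nonneg _))
    nlinarith
  have hae := (integral_eq_zero_iff_of_nonneg (fun x => sq_nonneg _) hV.integrable_sq).1 hJe
  filter_upwards [hae] with x hx
  have h1 : planeWave (shiftVec L τ) x * potential k q x = 0 := by simpa using hx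
  exact (mul_eq_zero.1 h1).resolve_left (Complex.exp_ne_zero _)

/-- An operator on continuous functions whose values are Lipschitz, uniformly on the unit ball,
is compact. -/
lemma isCompactOperator_of_lipschitz {X : Type*} [MetricSpace X] [CompactSpace X]
    (T : C(X, ℂ) →L[ℂ] C(X, ℂ)) (L : ℝ)
    (hL : ∀ u x y, ‖T u x - T u y‖ ≤ L * ‖u‖ * dist x y) : IsCompactOperator T := by
  refine (isCompactOperator_iff_isCompact_closure_image_ball T.toLinearMap one_pos).2 ?_
  set e := ContinuousMap.isometryEquivBoundedOfCompact X ℂ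
  have hc : IsCompact (closure (e '' (T.toLinearMap '' Metric.ball 0 1))) := by
    refine BoundedContinuousFunction.arzela_ascoli (Metric.closedBall 0 ‖T‖)
      (isCompact_closedBall _ _) _ ?_ ?_
    · rintro _ x ⟨_, ⟨u, hu, rfl⟩, rfl⟩
      rw [mem_closedBall_zero_iff]
      calc ‖T u x‖ ≤ ‖T u‖ := (T u).norm_coe_le_norm x
        _ ≤ ‖T‖ * ‖u‖ := T.le_opNorm u
        _ ≤ ‖T‖ := mul_le_of_le_one_right (norm_nonneg _) (mem_ball_zero_iff.1 hu).le
    · refine Metric.equicontinuous_of_continuity_modulus (fun t => |L| * t) ?_ _ ?_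
      · exact Continuous.tendsto' (by fun_prop) _ _ (by simp)
      · rintro x y ⟨_, _, ⟨u, hu, rfl⟩, rfl⟩
        rw [dist_eq_norm]
        refine (hL u x y).trans (mul_le_mul_of_nonneg_right ?_ dist_nonneg)
        calc L * ‖u‖ ≤ |L| * ‖u‖ := mul_le_mul_of_nonneg_right (le_abs_self _) (norm_nonneg _)
          _ ≤ |L| := mul_le_of_le_one_right (abs_nonneg _) (mem_ball_zero_iff.1 hu).le
  have := hc.image e.symm.continuous
  rwa [← IsometryEquiv.coe_toHomeomorph, Homeomorph.image_closure, IsometryEquiv.coe_toHomeomorph,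
    ← Set.image_comp, IsometryEquiv.symm_comp_self, Set.image_id] at this

lemma IsSource.norm_potential_sub_le {q : E3 → ℂ} {M R : ℝ} (h : IsSource q M R) (k : ℝ)
    (x x' : E3) :
    ‖potential k q x - potential k q x'‖ ≤
      M * ((|k| + 1) * (2 * volume.real (Metric.ball (0 : E3) R) + 2 * ∫ z, invSqCutoff z))
        * ‖x - x'‖ := by
  unfold potential
  rw [← integral_sub (h.integrable_greens k x) (h.integrable_greens k x')]
  have hI := ((integrable_indicator_ball R).const_mul 2)
  have hx := integrable_invSqCutoff_sub x
  have hx' := integrable_invSqCutoff_sub x'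
  have hi := ((hI.add (hx.add hx')).const_mul (M * (|k| + 1) * ‖x - x'‖))
  refine (norm_integral_le_of_norm_le hi (ae_of_all _ fun y => ?_)).trans (le_of_eq ?_)
  · have n1 := invSqCutoff_nonneg (x - y)
    have n1' := invSqCutoff_nonneg (x' - y)
    have n2 := norm_greens_sub_le k x x' y
    have n3 := h.bound y
    rw [← sub_mul, norm_mul]
    by_cases hy : ‖y‖ < R
    · simp only [Pi.add_apply]
      rw [Set.indicator_of_mem (by simpa using hy)]
      calc _ ≤ (|k| + 1) * (2 + invSqCutoff (x - y) + invSqCutoff (x' - y)) * ‖x - x'‖ * M :=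
            mul_le_mul n2 n3 (norm_nonneg _) ((norm_nonneg _).trans n2)
        _ = _ := by simp only [Pi.one_apply]; ring
    · rw [h.supp y (not_lt.1 hy)]
      simp only [norm_zero, mul_zero, Pi.add_apply]
      rw [Set.indicator_of_notMem (by simpa using hy)]
      have := h.nonneg
      positivity
  · rw [integral_const_mul]
    simp only [Pi.add_apply]
    have hs : ∫ y, (invSqCutoff (x - y) + invSqCutoff (x' - y)) = 2 * ∫ z, invSqCutoff z := by
      rw [integral_add hx hx', integral_invSqCutoff_sub, integral_invSqCutoff_sub, two_mul]
    have := integral_add hI (hx.add hx')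
    simp only [Pi.add_apply] at this
    rw [this, hs, integral_const_mul, integral_indicator_one Metric.isOpen_ball.measurableSet]
    ring

/-- The density `p u` on `Ω`, extended by zero to the whole space. -/
def density (Ω : Set E3) (p u : closure Ω → ℂ) : E3 → ℂ :=
  Ω.indicator fun y => if hy : y ∈ closure Ω then p ⟨y, hy⟩ * u ⟨y, hy⟩ else 0

lemma density_of_mem {Ω : Set E3} (p u : closure Ω → ℂ) {y : E3} (hy : y ∈ Ω) :
    density Ω p u y = p ⟨y, subset_closure hy⟩ * u ⟨y, subset_closure hy⟩ := by
  rw [density, Set.indicator_of_mem hy, dif_pos (subset_closure hy)]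

lemma density_of_notMem {Ω : Set E3} (p u : closure Ω → ℂ) {y : E3} (hy : y ∉ Ω) :
    density Ω p u y = 0 := Set.indicator_of_notMem hy _

lemma isSource_density {Ω : Set E3} (hΩo : IsOpen Ω) {R : ℝ} (hR : Ω ⊆ Metric.ball 0 R)
    {p u : closure Ω → ℂ} (hp : Continuous p) (hu : Continuous u) {P U : ℝ} (hP0 : 0 ≤ P)
    (hP : ∀ y, ‖p y‖ ≤ P) (hU0 : 0 ≤ U) (hU : ∀ y, ‖u y‖ ≤ U) :
    IsSource (density Ω p u) (P * U) R where
  meas := by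
    refine Measurable.indicator ?_ hΩo.measurableSet
    exact Measurable.dite (s := closure Ω) (hp.mul hu).measurable measurable_const
      isClosed_closure.measurableSet
  bound y := by
    by_cases hy : y ∈ Ω
    · rw [density_of_mem p u hy, norm_mul]
      exact mul_le_mul (hP _) (hU _) (norm_nonneg _) hP0
    · rw [density_of_notMem p u hy, norm_zero]
      positivity
  supp y hy := density_of_notMem p u fun h => by
    have := mem_ball_zero_iff.1 (hR h)
    linarith

lemma potential_density {Ω : Set E3} (hΩo : IsOpen Ω) (k : ℝ) (p u : closure Ω → ℂ) (x : E3) :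
    potential k (density Ω p u) x = ∫ y in Ω, greens k x y *
      (if hy : y ∈ closure Ω then p ⟨y, hy⟩ * u ⟨y, hy⟩ else 0) := by
  rw [potential, ← integral_indicator hΩo.measurableSet]
  refine integral_congr_ae (ae_of_all _ fun y => ?_)
  by_cases hy : y ∈ Ω <;> simp [density, hy]

/-- The homogeneous limiting equation has only the trivial solution. -/
lemma eq_zero_of_add_potential_density_eq_zero {k : ℝ} (hk : 0 < k) {Ω : Set E3}
    (hΩo : IsOpen Ω) {R : ℝ} (hR0 : 0 < R) (hR : Ω ⊆ Metric.ball 0 R)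
    {p u : closure Ω → ℂ} (hp : Continuous p) (hu : Continuous u) {P U : ℝ} (hP0 : 0 ≤ P)
    (hP : ∀ y, ‖p y‖ ≤ P) (hU0 : 0 ≤ U) (hU : ∀ y, ‖u y‖ ≤ U) (him : ∀ y, (p y).im ≤ 0)
    (heq : ∀ x : closure Ω, u x + potential k (density Ω p u) x = 0) : u = 0 := by
  have h := isSource_density hΩo hR hp hu hP0 hP hU0 hU
  have hw (y : E3) (hy : y ∈ Ω) :
      potential k (density Ω p u) y = -u ⟨y, subset_closure hy⟩ :=
    eq_neg_of_add_eq_zero_right (heq ⟨y, subset_closure hy⟩)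
  have hE : (∫ x, starRingEnd ℂ (density Ω p u x) * potential k (density Ω p u) x).im ≤ 0 := by
    obtain ⟨C, hC⟩ := h.exists_norm_potential_le k
    have hmul : Integrable
        (fun x => starRingEnd ℂ (density Ω p u x) * potential k (density Ω p u) x) := by
      have := h.conj.integrable_mul (h.measurable_potential k) (C := C) fun y _ => hC y
      exact this.congr (ae_of_all _ fun y => mul_comm _ _)
    have h1 := integral_im hmul
    simp only [RCLike.im_to_complex] at h1
    rw [← h1]
    refine integral_nonpos fun x => ?_
    by_cases hx : x ∈ Ω
    · have := him ⟨x, subset_closure hx⟩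
      simp only [hw x hx, density_of_mem p u hx, map_mul, Pi.zero_apply]
      set a := p ⟨x, subset_closure hx⟩
      set b := u ⟨x, subset_closure hx⟩
      have hab : starRingEnd ℂ a * starRingEnd ℂ b * -b
          = -(starRingEnd ℂ a * (Complex.normSq b : ℂ)) := by
        rw [Complex.normSq_eq_conj_mul_self]; ring
      rw [hab]
      simp only [Complex.neg_im, Complex.im_mul_ofReal, Complex.conj_im]
      have := mul_nonneg (neg_nonneg.2 this) (Complex.normSq_nonneg b)
      linarith
    · simp [density_of_notMem p u hx]
  have hfar (x : E3) (hx : 9 * R ≤ ‖x‖) : potential k (density Ω p u) x = 0 :=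
    h.potential_eq_zero_of_neg_eq hR0 hk (h.potential_neg_eq hk hE) (by linarith)
  have hdom (x : E3) : ‖density Ω p u x‖ ≤ P * ‖potential k (density Ω p u) x‖ := by
    by_cases hx : x ∈ Ω
    · rw [hw x hx, density_of_mem p u hx, norm_mul, norm_neg]
      exact mul_le_mul_of_nonneg_right (hP _) (norm_nonneg _)
    · rw [density_of_notMem p u hx, norm_zero]
      positivity
  have hae := h.potential_ae_eq_zero hR0 k hfar hP0 hdom
  have hopen : IsOpen (((↑) : closure Ω → E3) '' {x | u x ≠ 0} ∩ Ω) := by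
    obtain ⟨V, hV, hVu⟩ := isOpen_induced_iff.1 (isOpen_ne_fun hu continuous_const :
      IsOpen {x | u x ≠ 0})
    rw [← hVu, Subtype.image_preimage_coe]
    convert hV.inter hΩo using 1
    ext x
    have : x ∈ Ω → x ∈ closure Ω := fun h => subset_closure h
    simp only [Set.mem_inter_iff]
    tauto
  have hempty : ((↑) : closure Ω → E3) '' {x | u x ≠ 0} ∩ Ω = ∅ := by
    by_contra hne
    refine (hopen.measure_pos volume (Set.nonempty_iff_ne_empty.2 hne)).ne'
      (measure_mono_null ?_ (ae_iff.1 hae))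
    rintro _ ⟨⟨x, hx, rfl⟩, hxΩ⟩ h0
    rw [hw x hxΩ] at h0
    exact hx (neg_eq_zero.1 h0)
  have hΩ0 (y : E3) (hy : y ∈ Ω) : u ⟨y, subset_closure hy⟩ = 0 := by
    by_contra h0
    exact (Set.eq_empty_iff_forall_notMem.1 hempty y) ⟨⟨_, h0, rfl⟩, hy⟩
  have hdense : Dense (((↑) : closure Ω → E3) ⁻¹' Ω) := by
    intro x
    rw [closure_subtype, Subtype.image_preimage_coe, Set.inter_eq_self_of_subset_right subset_closure]
    exact x.2
  exact hu.ext_on hdense continuous_const fun x hx => hΩ0 x hx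

/-- The Fredholm alternative, at the value `-1` of the spectral parameter. -/
lemma IsCompactOperator.isUnit_one_add {X : Type*} [NormedAddCommGroup X] [NormedSpace ℂ X]
    [CompleteSpace X] {T : X →L[ℂ] X} (hT : IsCompactOperator T)
    (hinj : ∀ u, u + T u = 0 → u = 0) : IsUnit (1 + T) := by
  rcases hT.hasEigenvalue_or_mem_resolventSet (neg_ne_zero.2 one_ne_zero : (-1 : ℂ) ≠ 0) with h | h
  · obtain ⟨u, hu⟩ := h.exists_hasEigenvector
    refine absurd (hinj u ?_) hu.2
    have := hu.apply_eq_smul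
    rw [ContinuousLinearMap.coe_coe] at this
    rw [this]
    simp
  · rw [spectrum.mem_resolventSet_iff, map_neg, map_one, ← IsUnit.neg_iff] at h
    convert h using 1
    abel

/-- For `k > 0`, a nonempty bounded open `Ω ⊂ ℝ³` with closure `K`, and continuous
`p : K → ℂ` with `Im p ≤ 0`, the operator `I + T` with
`(T u)(x) = ∫_Ω G(x,y) p(y) u(y) dy` is bijective on `C(K, ℂ)` with bounded (continuous
linear) inverse: for every `f` the equation `u + T u = f` has exactly one solution,
depending continuously on `f`. -/
theorem limiting_IE_boundedly_invertible (k : ℝ) (hk : 0 < k)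
    (Ω : Set E3) (hΩo : IsOpen Ω) (hne : Ω.Nonempty) (hb : Bornology.IsBounded Ω)
    (p : closure Ω → ℂ) (hp : Continuous p)
    (him : ∀ y : closure Ω, (p y).im ≤ 0) :
    letI : CompactSpace (closure Ω) := isCompact_iff_compactSpace.mp hb.isCompact_closure
    ∀ T : C(closure Ω, ℂ) →L[ℂ] C(closure Ω, ℂ),
      (∀ (u : C(closure Ω, ℂ)) (x : closure Ω),
        T u x = ∫ y in Ω, greens k (x : E3) y *
          (if hy : y ∈ closure Ω then p ⟨y, hy⟩ * u ⟨y, hy⟩ else 0)) →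
      Function.Bijective (fun u : C(closure Ω, ℂ) => u + T u) ∧
      ∃ S : C(closure Ω, ℂ) →L[ℂ] C(closure Ω, ℂ),
        (∀ f : C(closure Ω, ℂ), S f + T (S f) = f) ∧
        (∀ u : C(closure Ω, ℂ), S (u + T u) = u) := by
  have : CompactSpace (closure Ω) := isCompact_iff_compactSpace.mp hb.isCompact_closure
  intro T hT
  obtain ⟨R, hR0, hR⟩ := hb.subset_ball_lt 0 0
  obtain ⟨P, hP⟩ : ∃ P, ∀ y, ‖p y‖ ≤ P :=
    ⟨_, fun y => (ContinuousMap.mk p hp).norm_coe_le_norm y⟩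
  have hP0 : 0 ≤ P := hne.elim fun y hy => (norm_nonneg _).trans (hP ⟨y, subset_closure hy⟩)
  simp_rw [← potential_density hΩo] at hT
  have hsrc (u : C(closure Ω, ℂ)) : IsSource (density Ω p u) (P * ‖u‖) R :=
    isSource_density hΩo hR hp u.continuous hP0 hP (norm_nonneg u) u.norm_coe_le_norm
  have hcomp : IsCompactOperator T := by
    refine isCompactOperator_of_lipschitz T
      (P * ((|k| + 1) * (2 * volume.real (Metric.ball (0 : E3) R) + 2 * ∫ z, invSqCutoff z)))
      fun u x y => ?_
    rw [hT, hT, Subtype.dist_eq, dist_eq_norm]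
    refine ((hsrc u).norm_potential_sub_le k x y).trans (le_of_eq ?_)
    ring
  have hunit := hcomp.isUnit_one_add fun u hu => DFunLike.coe_injective <|
    eq_zero_of_add_potential_density_eq_zero hk hΩo hR0 hR hp u.continuous hP0 hP
      (norm_nonneg u) u.norm_coe_le_norm him fun x => by
        rw [← hT]
        exact DFunLike.congr_fun hu x
  obtain ⟨S, hS1, hS2⟩ := isUnit_iff_exists.1 hunit
  have h1 (f : C(closure Ω, ℂ)) : S f + T (S f) = f := DFunLike.congr_fun hS1 f
  have h2 (u : C(closure Ω, ℂ)) : S (u + T u) = u := DFunLike.congr_fun hS2 u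
  exact ⟨⟨Function.LeftInverse.injective (g := S) h2, Function.RightInverse.surjective h1⟩,
    S, h1, h2⟩

end
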